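/- arXiv:1606.07395 — 12 statements merged into one kernel-verified Lean document; each statement's English description precedes it below -/
import Mathlib

section
/- Let K be an infinite field and I an ideal of the multivariate polynomial ring K[x₁,…,xₙ]. Then the set New(I) = {New(f) : f ∈ I, f ≠ 0} is a sub-semimodule of the polytope semiring; concretely: (i) for all nonzero f, g ∈ I there exists a nonzero h ∈ I with New(h) = convexHull ℝ (New(f) ∪ New(g)); and (ii) for every nonzero f ∈ I and every nonzero polynomial p ∈ K[x₁,…,xₙ], the product f·p is a nonzero element of I and New(f·p) = New(f) + New(p) (Minkowski sum). -/
open Pointwise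

/-- A lattice polytope in `ℝⁿ`: the convex hull of a nonempty finite set of points
all of whose coordinates are nonnegative integers. -/
def IsLatticePolytope {n : ℕ} (P : Set (Fin n → ℝ)) : Prop :=
  ∃ F : Finset (Fin n → ℝ), F.Nonempty ∧ (∀ x ∈ F, ∀ i, ∃ m : ℕ, x i = (m : ℝ)) ∧
    P = convexHull ℝ (F : Set (Fin n → ℝ))

/-- The Newton polytope of a multivariate polynomial: the convex hull of the images in `ℝⁿ`
of the exponent vectors in its support. -/
noncomputable def newton {K : Type*} [CommSemiring K] {n : ℕ}
    (f : MvPolynomial (Fin n) K) : Set (Fin n → ℝ) :=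
  convexHull ℝ ((fun d : Fin n →₀ ℕ => fun i : Fin n => (d i : ℝ)) '' ↑f.support)

/-- Over an infinite field, some combination `f + c g` has no cancellation. -/
theorem MvPolynomial.exists_support_add_C_mul_eq_union {K σ : Type*} [Field K] [Infinite K]
    [DecidableEq σ] (f g : MvPolynomial σ K) :
    ∃ c : K, (f + C c * g).support = f.support ∪ g.support := by
  classical
  obtain ⟨c, hc⟩ := Infinite.exists_notMem_finset
    ((f.support ∪ g.support).image fun d => -(coeff d f) / coeff d g)
  simp only [Finset.mem_image, not_exists, not_and] at hc
  refine ⟨c, Finset.ext fun d => ⟨fun hd => ?_, fun hd => ?_⟩⟩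
  · by_contra hd'
    simp only [Finset.mem_union, mem_support_iff, not_or, not_not] at hd'
    simp [hd'.1, hd'.2] at hd
  · rw [mem_support_iff, coeff_add, coeff_C_mul]
    intro h0
    by_cases hg : coeff d g = 0
    · simp_all
    · exact hc d hd (by rw [div_eq_iff hg]; linear_combination -h0)

/-- The convex hull of a finite set is the convex hull of its extreme points. -/
theorem Set.Finite.convexHull_extremePoints_convexHull {E : Type*} [AddCommGroup E] [Module ℝ E]
    [TopologicalSpace E] [T2Space E] [IsTopologicalAddGroup E] [ContinuousSMul ℝ E]
    [LocallyConvexSpace ℝ E] {s : Set E} (hs : s.Finite) :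
    convexHull ℝ ((convexHull ℝ s).extremePoints ℝ) = convexHull ℝ s := by
  have hfin : ((convexHull ℝ s).extremePoints ℝ).Finite :=
    hs.subset extremePoints_convexHull_subset
  rw [← (hfin.isClosed_convexHull ℝ).closure_eq]
  exact closure_convexHull_extremePoints (hs.isCompact_convexHull ℝ) (convex_convexHull ℝ s)

/-- An extreme point of a Minkowski sum decomposes uniquely. -/
theorem eq_and_eq_of_add_mem_extremePoints_add {E : Type*} [AddCommGroup E] [Module ℝ E]
    {s t : Set E} {a a' b b' : E} (ha : a ∈ s) (hb : b ∈ t) (ha' : a' ∈ s) (hb' : b' ∈ t)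
    (h : a + b ∈ (s + t).extremePoints ℝ) (heq : a' + b' = a + b) : a' = a ∧ b' = b := by
  have hmid : a + b ∈ openSegment ℝ (a + b') (a' + b) := by
    refine ⟨2⁻¹, 2⁻¹, by norm_num, by norm_num, by norm_num, ?_⟩
    rw [← smul_add, show a + b' + (a' + b) = (2 : ℝ) • (a + b) by
      rw [two_smul]; nth_rewrite 1 [← heq]; abel, smul_smul]
    norm_num
  have hb_eq : b' = b := add_left_cancel
    (h.2 (Set.add_mem_add ha hb') (Set.add_mem_add ha' hb) hmid)
  exact ⟨add_right_cancel (hb_eq ▸ heq), hb_eq⟩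

/-- Newton polytopes turn products into Minkowski sums. -/
theorem newton_mul {K : Type*} [CommSemiring K] [NoZeroDivisors K] {n : ℕ}
    (f p : MvPolynomial (Fin n) K) : newton (f * p) = newton f + newton p := by
  classical
  set φ : (Fin n →₀ ℕ) → Fin n → ℝ := fun d i => (d i : ℝ) with hφ
  have hφ_add (d e) : φ (d + e) = φ d + φ e := by ext; simp [hφ]
  have hφ_inj : Function.Injective φ := fun d e h => by
    ext i; exact Nat.cast_injective (congrFun h i)
  have hsum : newton f + newton p = convexHull ℝ (φ '' f.support + φ '' p.support) :=
    (convexHull_add _ _).symm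
  apply subset_antisymm
  · rw [hsum]
    refine convexHull_mono ?_
    rintro _ ⟨d, hd, rfl⟩
    obtain ⟨a, ha, b, hb, rfl⟩ := Finset.mem_add.1 (MvPolynomial.support_mul f p hd)
    exact ⟨φ a, ⟨a, ha, rfl⟩, φ b, ⟨b, hb, rfl⟩, (hφ_add a b).symm⟩
  · have hfin : (φ '' f.support + φ '' p.support).Finite :=
      (f.support.finite_toSet.image φ).add (p.support.finite_toSet.image φ)
    rw [hsum, ← hfin.convexHull_extremePoints_convexHull]
    refine convexHull_mono fun x hx => ?_
    obtain ⟨_, ⟨a, ha, rfl⟩, _, ⟨b, hb, rfl⟩, rfl⟩ := extremePoints_convexHull_subset hx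
    refine ⟨a + b, ?_, hφ_add a b⟩
    rw [← hsum] at hx
    have mem {q : MvPolynomial (Fin n) K} {d} (hd : d ∈ q.support) : φ d ∈ newton q :=
      subset_convexHull ℝ _ ⟨d, hd, rfl⟩
    rw [Finset.mem_coe, MvPolynomial.mem_support_iff, MvPolynomial.coeff_mul,
      Finset.sum_eq_single (a, b)]
    · exact mul_ne_zero (MvPolynomial.mem_support_iff.1 ha) (MvPolynomial.mem_support_iff.1 hb)
    · rintro ⟨a', b'⟩ hab hne
      by_contra h0
      have h := eq_and_eq_of_add_mem_extremePoints_add (mem ha) (mem hb)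
        (mem (MvPolynomial.mem_support_iff.2 (left_ne_zero_of_mul h0)))
        (mem (MvPolynomial.mem_support_iff.2 (right_ne_zero_of_mul h0))) hx
        (by rw [← hφ_add, ← hφ_add, Finset.HasAntidiagonal.mem_antidiagonal.1 hab])
      exact hne (Prod.ext (hφ_inj h.1) (hφ_inj h.2))
    · simp

/-- `New(I)` is a sub-semimodule of the polytope semiring. -/
theorem newton_image_subsemimodule {K : Type*} [Field K] [Infinite K] {n : ℕ}
    (I : Ideal (MvPolynomial (Fin n) K)) :
    (∀ f g : MvPolynomial (Fin n) K, f ∈ I → g ∈ I → f ≠ 0 → g ≠ 0 →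
      ∃ h : MvPolynomial (Fin n) K, h ∈ I ∧ h ≠ 0 ∧
        newton h = convexHull ℝ (newton f ∪ newton g)) ∧
    (∀ f p : MvPolynomial (Fin n) K, f ∈ I → f ≠ 0 → p ≠ 0 →
      f * p ∈ I ∧ f * p ≠ 0 ∧ newton (f * p) = newton f + newton p) := by
  refine ⟨fun f g hf hg hf0 _ => ?_, fun f p hf hf0 hp0 =>
    ⟨I.mul_mem_right p hf, mul_ne_zero hf0 hp0, newton_mul f p⟩⟩
  obtain ⟨c, hc⟩ := f.exists_support_add_C_mul_eq_union g
  refine ⟨f + MvPolynomial.C c * g, I.add_mem hf (I.mul_mem_left _ hg), ?_, ?_⟩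
  · rw [← MvPolynomial.support_nonempty, hc]
    exact (MvPolynomial.support_nonempty.2 hf0).mono Finset.subset_union_left
  · simp only [newton, hc, Finset.coe_union, Set.image_union,
      convexHull_convexHull_union_left, convexHull_convexHull_union_right]
end

section
/- Let M be a set of lattice polytopes in ℝⁿ that is a sub-semimodule of the polytope semiring, i.e. closed under P ⊕ Q for P, Q ∈ M and under A ⊙ P for P ∈ M and A any lattice polytope. Say a subset G ⊆ M generates M if every P ∈ M can be written P = convexHull ℝ (⋃_{j∈J} (A_j + H_j)) for some nonempty finite family with each A_j a lattice polytope and each H_j ∈ G, and call G minimal if no proper subset of G generates M. Then M has at most one minimal generating set: any two minimal generating sets of M are equal (as sets of polytopes). -/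
open Pointwise

/-- `G` generates the sub-semimodule `M`: every `P ∈ M` is an `𝒜`-linear combination of
elements of `G`, i.e. `P = convexHull ℝ (⋃_{j ∈ J} (A j + H j))` for a nonempty finite family
with each `A j` a lattice polytope and each `H j ∈ G`. -/
def Generates {n : ℕ} (M G : Set (Set (Fin n → ℝ))) : Prop :=
  ∀ P ∈ M, ∃ (J : Finset ℕ) (A H : ℕ → Set (Fin n → ℝ)), J.Nonempty ∧
    (∀ j ∈ J, IsLatticePolytope (A j) ∧ H j ∈ G) ∧
    P = convexHull ℝ (⋃ j ∈ J, (A j + H j))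

namespace IsLatticePolytope

variable {n : ℕ} {P Q : Set (Fin n → ℝ)}

theorem nonempty (hP : IsLatticePolytope P) : P.Nonempty := by
  obtain ⟨F, hF, -, rfl⟩ := hP
  exact hF.to_set.convexHull

theorem convex (hP : IsLatticePolytope P) : Convex ℝ P := by
  obtain ⟨F, -, -, rfl⟩ := hP
  exact convex_convexHull ℝ _

theorem isCompact (hP : IsLatticePolytope P) : IsCompact P := by
  obtain ⟨F, -, -, rfl⟩ := hP
  exact F.finite_toSet.isCompact_convexHull ℝ

theorem nonneg (hP : IsLatticePolytope P) {x : Fin n → ℝ} (hx : x ∈ P) : 0 ≤ x := by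
  obtain ⟨F, -, hF, rfl⟩ := hP
  refine convexHull_min (fun y hy i => ?_) (convex_Ici (𝕜 := ℝ) (0 : Fin n → ℝ)) hx
  obtain ⟨m, hm⟩ := hF y hy i
  simp [hm]

theorem singleton_zero : IsLatticePolytope ({0} : Set (Fin n → ℝ)) :=
  ⟨{0}, by simp, by simpa using fun _ => ⟨0, by simp⟩, by simp⟩

theorem add (hP : IsLatticePolytope P) (hQ : IsLatticePolytope Q) :
    IsLatticePolytope (P + Q) := by
  classical
  obtain ⟨F, hF, hFn, rfl⟩ := hP
  obtain ⟨K, hK, hKn, rfl⟩ := hQ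
  refine ⟨F + K, hF.add hK, fun x hx i => ?_, by rw [Finset.coe_add, convexHull_add]⟩
  obtain ⟨y, hy, z, hz, rfl⟩ := Finset.mem_add.mp hx
  obtain ⟨a, ha⟩ := hFn y hy i
  obtain ⟨b, hb⟩ := hKn z hz i
  exact ⟨a + b, by simp [ha, hb]⟩

/-- A translation mapping a lattice polytope into itself has no positive coordinate. -/
theorem nonpos_of_forall_add_mem (hP : IsLatticePolytope P) {a : Fin n → ℝ}
    (ha : ∀ x ∈ P, a + x ∈ P) : a ≤ 0 := by
  intro i
  obtain ⟨x, hx, hmax⟩ :=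
    hP.isCompact.exists_isMaxOn hP.nonempty (continuous_apply i).continuousOn
  have h : (a + x) i ≤ x i := hmax (ha x hx)
  simpa using h

theorem eq_singleton_zero (hP : IsLatticePolytope P) (h : ∀ x ∈ P, x = 0) : P = {0} :=
  Set.eq_singleton_iff_nonempty_unique_mem.mpr ⟨hP.nonempty, h⟩

/-- If `A + B + P ⊆ P` for lattice polytopes, then `A` and `B` are trivial. -/
theorem eq_zero_of_add_add_subset {A B : Set (Fin n → ℝ)} (hP : IsLatticePolytope P)
    (hA : IsLatticePolytope A) (hB : IsLatticePolytope B) (h : A + (B + P) ⊆ P) :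
    A = {0} ∧ B = {0} := by
  have key : ∀ a ∈ A, ∀ b ∈ B, a = 0 ∧ b = 0 := by
    intro a ha b hb
    have hab : a + b ≤ 0 := hP.nonpos_of_forall_add_mem fun x hx => by
      rw [add_assoc]
      exact h (Set.add_mem_add ha (Set.add_mem_add hb hx))
    exact (add_eq_zero_iff_of_nonneg (hA.nonneg ha) (hB.nonneg hb)).mp
      (le_antisymm hab (add_nonneg (hA.nonneg ha) (hB.nonneg hb)))
  obtain ⟨a₀, ha₀⟩ := hA.nonempty
  obtain ⟨b₀, hb₀⟩ := hB.nonempty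
  exact ⟨hA.eq_singleton_zero fun a ha => (key a ha b₀ hb₀).1,
    hB.eq_singleton_zero fun b hb => (key a₀ ha₀ b hb).2⟩

end IsLatticePolytope

/-- `P` is a linear combination, over the polytope semiring, of elements of `G`. -/
def IsPolytopeCombination {n : ℕ} (G : Set (Set (Fin n → ℝ))) (P : Set (Fin n → ℝ)) : Prop :=
  ∃ (J : Finset ℕ) (A H : ℕ → Set (Fin n → ℝ)), J.Nonempty ∧
    (∀ j ∈ J, IsLatticePolytope (A j) ∧ H j ∈ G) ∧
    P = convexHull ℝ (⋃ j ∈ J, (A j + H j))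

theorem convexHull_iUnion_convexHull {E ι : Type*} [AddCommGroup E] [Module ℝ E]
    (s : ι → Set E) :
    convexHull ℝ (⋃ i, convexHull ℝ (s i)) = convexHull ℝ (⋃ i, s i) :=
  (convexHull ℝ).closure_iSup_closure s

namespace IsPolytopeCombination

variable {n : ℕ} {G G' : Set (Set (Fin n → ℝ))} {P : Set (Fin n → ℝ)}

theorem of_finite {ι : Type*} [Finite ι] [Nonempty ι] {A H : ι → Set (Fin n → ℝ)}
    (hA : ∀ i, IsLatticePolytope (A i)) (hH : ∀ i, H i ∈ G) :
    IsPolytopeCombination G (convexHull ℝ (⋃ i, (A i + H i))) := by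
  have := Fintype.ofFinite ι
  obtain ⟨f, hf⟩ := Countable.exists_injective_nat ι
  refine ⟨Finset.univ.map ⟨f, hf⟩, fun k => A (Function.invFun f k),
    fun k => H (Function.invFun f k), by simp, fun _ _ => ⟨hA _, hH _⟩, ?_⟩
  simp [Function.leftInverse_invFun hf _]

theorem of_mem (hP : P ∈ G) (hconv : Convex ℝ P) : IsPolytopeCombination G P := by
  have h := of_finite (G := G) (ι := Unit) (A := fun _ => {0}) (H := fun _ => P)
    (fun _ => IsLatticePolytope.singleton_zero) (fun _ => hP)
  simpa [Set.iUnion_const, hconv.convexHull_eq] using h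

theorem trans (hP : IsPolytopeCombination G P) (hG : ∀ H ∈ G, IsPolytopeCombination G' H) :
    IsPolytopeCombination G' P := by
  obtain ⟨J, A, H, hJ, hAH, rfl⟩ := hP
  choose K B L hK hBL hH using fun j : J => hG (H j) (hAH j j.2).2
  have : Nonempty J := hJ.to_subtype
  have (j : J) : Nonempty (K j) := (hK j).to_subtype
  have : Nonempty (Σ j : J, K j) := nonempty_sigma.mpr ⟨Classical.arbitrary J, inferInstance⟩
  have h := of_finite (G := G') (ι := Σ j : J, K j) (A := fun p => A p.1 + B p.1 p.2)
    (H := fun p => L p.1 p.2) (fun p => (hAH p.1 p.1.2).1.add (hBL p.1 p.2 p.2.2).1)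
    (fun p => (hBL p.1 p.2 p.2.2).2)
  convert h using 1
  rw [Set.iUnion_sigma, ← convexHull_iUnion_convexHull fun j : J => ⋃ k : K j, _,
    ← Set.iUnion_subtype (· ∈ J) fun j => A j + H j]
  congr 1
  refine Set.iUnion_congr fun j => ?_
  conv_lhs => rw [hH j, ← (hAH j j.2).1.convex.convexHull_eq, ← convexHull_add,
    ← Set.iUnion_subtype (· ∈ K j) fun k => B j k + L j k, Set.add_iUnion]
  simp only [add_assoc]

end IsPolytopeCombination

theorem subset_of_generates_of_minimal {n : ℕ} {M G₁ G₂ : Set (Set (Fin n → ℝ))}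
    (hMlat : ∀ P ∈ M, IsLatticePolytope P) (hG₁ : G₁ ⊆ M) (hG₂ : G₂ ⊆ M)
    (hgen₁ : Generates M G₁) (hgen₂ : Generates M G₂)
    (hmin₁ : ∀ G' ⊂ G₁, ¬ Generates M G') : G₁ ⊆ G₂ := by
  intro g hg
  by_contra hg₂
  have hgM := hG₁ hg
  obtain ⟨J, A, H, hJ, hAH, hgeq⟩ := hgen₂ g hgM
  have hg_comb : IsPolytopeCombination (G₁ \ {g}) g := by
    suffices hH : ∀ h ∈ H '' J, IsPolytopeCombination (G₁ \ {g}) h from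
      IsPolytopeCombination.trans
        ⟨J, A, H, hJ, fun j hj => ⟨(hAH j hj).1, Set.mem_image_of_mem H hj⟩, hgeq⟩ hH
    rintro _ ⟨j, hj, rfl⟩
    obtain ⟨hAj, hHj⟩ := hAH j hj
    obtain ⟨K, B, L, hK, hBL, hHeq⟩ := hgen₁ (H j) (hG₂ hHj)
    refine ⟨K, B, L, hK, fun k hk => ⟨(hBL k hk).1, (hBL k hk).2, fun hLg => hg₂ ?_⟩, hHeq⟩
    have hLg : L k = g := hLg
    have hsub₁ : A j + H j ⊆ g := by
      rw [hgeq]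
      exact (Set.subset_biUnion_of_mem (u := fun j => A j + H j) hj).trans
        (subset_convexHull ℝ _)
    have hsub₂ : B k + g ⊆ H j := by
      rw [hHeq, ← hLg]
      exact (Set.subset_biUnion_of_mem (u := fun k => B k + L k) hk).trans
        (subset_convexHull ℝ _)
    obtain ⟨hA0, hB0⟩ := (hMlat g hgM).eq_zero_of_add_add_subset hAj (hBL k hk).1
      ((Set.add_subset_add_left hsub₂).trans hsub₁)
    rw [hA0, Set.singleton_zero, zero_add] at hsub₁
    rw [hB0, Set.singleton_zero, zero_add] at hsub₂
    rwa [hsub₂.antisymm hsub₁]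
  refine hmin₁ (G₁ \ {g}) (Set.sdiff_singleton_ssubset.mpr hg) fun P hP => ?_
  refine IsPolytopeCombination.trans (hgen₁ P hP) fun h hh => ?_
  by_cases hhg : h = g
  · rwa [hhg]
  · exact .of_mem ⟨hh, hhg⟩ (hMlat h (hG₁ hh)).convex

/-- A sub-semimodule of the polytope semiring has at most one minimal generating set. -/
theorem minimal_generating_set_unique {n : ℕ} (M : Set (Set (Fin n → ℝ)))
    (hMlat : ∀ P ∈ M, IsLatticePolytope P)
    (hMoplus : ∀ P ∈ M, ∀ Q ∈ M, convexHull ℝ (P ∪ Q) ∈ M)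
    (hModot : ∀ P ∈ M, ∀ A : Set (Fin n → ℝ), IsLatticePolytope A → A + P ∈ M)
    (G₁ G₂ : Set (Set (Fin n → ℝ))) (hG₁ : G₁ ⊆ M) (hG₂ : G₂ ⊆ M)
    (hgen₁ : Generates M G₁) (hgen₂ : Generates M G₂)
    (hmin₁ : ∀ G' ⊂ G₁, ¬ Generates M G') (hmin₂ : ∀ G' ⊂ G₂, ¬ Generates M G') :
    G₁ = G₂ := by
  exact (subset_of_generates_of_minimal hMlat hG₁ hG₂ hgen₁ hgen₂ hmin₁).antisymm
    (subset_of_generates_of_minimal hMlat hG₂ hG₁ hgen₂ hgen₁ hmin₂)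
end

section
/- Let K be an infinite field, I a homogeneous ideal of K[x₁,…,xₙ], and k ∈ ℕ; let I_k denote the K-vector space of homogeneous degree-k elements of I. Suppose f₁,…,f_r are nonzero homogeneous degree-k elements of I such that for every nonzero homogeneous degree-k element g of I there is a nonempty subset T ⊆ {1,…,r} with New(g) = convexHull ℝ (⋃_{j∈T} New(f_j)). Then f₁,…,f_r span I_k as a K-vector space; in particular dim_K I_k ≤ r, so the k-th Newton–Hilbert coefficient of I is at least its k-th Hilbert coefficient. -/
open Pointwise

/-- The exponent `d` read as the digits, in base `b`, of a natural number. -/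
def digitWeight {n : ℕ} (b : ℕ) (d : Fin n →₀ ℕ) : ℕ := ∑ i, d i * b ^ (i : ℕ)

theorem digitWeight_injOn {n : ℕ} {k : ℕ} {d e : Fin n →₀ ℕ} (hd : ∀ i, d i ≤ k)
    (he : ∀ i, e i ≤ k) (h : digitWeight (k + 1) d = digitWeight (k + 1) e) : d = e := by
  have key : (fun i => (⟨d i, Nat.lt_succ_of_le (hd i)⟩ : Fin (k + 1))) =
      fun i => ⟨e i, Nat.lt_succ_of_le (he i)⟩ := by
    apply finFunctionFinEquiv.injective
    apply Fin.ext
    simpa only [finFunctionFinEquiv_apply, digitWeight] using h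
  ext i
  exact congrArg Fin.val (congrFun key i)

theorem MvPolynomial.IsHomogeneous.apply_le_of_mem_support {σ R : Type*} [CommSemiring R]
    {k : ℕ} {p : MvPolynomial σ R} (hp : p.IsHomogeneous k) {d : σ →₀ ℕ} (hd : d ∈ p.support)
    (i : σ) : d i ≤ k := by
  have h : d.degree = k := by
    rw [← hp (MvPolynomial.mem_support_iff.mp hd), Finsupp.degree_eq_weight_one]
    rfl
  exact (Finsupp.le_degree i d).trans_eq h

/-- The linear functional on `ℝⁿ` extending `digitWeight b`. -/
noncomputable def digitFunctional (n b : ℕ) : (Fin n → ℝ) →ₗ[ℝ] ℝ :=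
  ∑ i : Fin n, ((b : ℝ) ^ (i : ℕ)) • LinearMap.proj i

theorem digitFunctional_natCast {n : ℕ} (b : ℕ) (d : Fin n →₀ ℕ) :
    digitFunctional n b (fun i => (d i : ℝ)) = digitWeight b d := by
  simp [digitFunctional, digitWeight, mul_comm]

theorem natCast_mem_newton {K : Type*} [CommSemiring K] {n : ℕ} {f : MvPolynomial (Fin n) K}
    {d : Fin n →₀ ℕ} (hd : d ∈ f.support) : (fun i => (d i : ℝ)) ∈ newton f :=
  subset_convexHull ℝ _ ⟨d, hd, rfl⟩

theorem newton_subset {K : Type*} [CommSemiring K] {n : ℕ} {f : MvPolynomial (Fin n) K}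
    {s : Set (Fin n → ℝ)} (hs : Convex ℝ s) (h : ∀ d ∈ f.support, (fun i => (d i : ℝ)) ∈ s) :
    newton f ⊆ s := by
  refine convexHull_min ?_ hs
  rintro _ ⟨d, hd, rfl⟩
  exact h d hd

/-- If `New(g)` is the convex hull of some of the `New(f j)`, the exponents of `g` of maximal
weight have the weight of an exponent of some `f j` of maximal weight. -/
theorem exists_digitWeight_eq_of_newton_eq {K : Type*} [CommSemiring K] {n r : ℕ} (b : ℕ)
    {f : Fin r → MvPolynomial (Fin n) K} {g : MvPolynomial (Fin n) K} {T : Finset (Fin r)}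
    (hT : newton g = convexHull ℝ (⋃ j ∈ T, newton (f j))) {d : Fin n →₀ ℕ}
    (hd : d ∈ g.support) (hmax : ∀ e ∈ g.support, digitWeight b e ≤ digitWeight b d) :
    ∃ j, (∃ e ∈ (f j).support, digitWeight b e = digitWeight b d) ∧
      ∀ e ∈ (f j).support, digitWeight b e ≤ digitWeight b d := by
  have hle : ∀ j ∈ T, ∀ e ∈ (f j).support, digitWeight b e ≤ digitWeight b d := by
    intro j hj e he
    have hg : newton g ⊆ {x | digitFunctional n b x ≤ digitWeight b d} :=
      newton_subset (convex_halfSpace_le (digitFunctional n b).isLinear _) fun e he => by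
        simpa [digitFunctional_natCast] using hmax e he
    have hmem : (fun i => (e i : ℝ)) ∈ newton g := by
      rw [hT]
      exact subset_convexHull ℝ _ (Set.mem_biUnion hj (natCast_mem_newton he))
    simpa [digitFunctional_natCast] using hg hmem
  by_contra! hcon
  have hlt : ∀ j ∈ T, ∀ e ∈ (f j).support, digitWeight b e < digitWeight b d := by
    intro j hj e he
    refine (hle j hj e he).lt_of_ne fun h => ?_
    obtain ⟨e', he', hlt'⟩ := hcon j ⟨e, he, h⟩
    exact (hle j hj e' he').not_gt hlt'
  have hconv := convex_halfSpace_lt (digitFunctional n b).isLinear (digitWeight b d : ℝ)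
  have hg : newton g ⊆ {x | digitFunctional n b x < digitWeight b d} := by
    rw [hT]
    refine convexHull_min (Set.iUnion₂_subset fun j hj => newton_subset hconv fun e he => ?_) hconv
    simpa [digitFunctional_natCast] using hlt j hj e he
  simpa [digitFunctional_natCast] using hg (natCast_mem_newton hd)

/-- Every nonzero homogeneous degree-`k` element `g` of `I` can be reduced to zero by successively
cancelling its term of maximal weight against a multiple of some `f j`, provided `New(g)` is always
a convex hull of a union of some of the `New(f j)`. -/
theorem mem_span_of_digitWeight_lt {K : Type*} [Field K] {n : ℕ}
    (I : Ideal (MvPolynomial (Fin n) K)) (k : ℕ) (r : ℕ) (f : Fin r → MvPolynomial (Fin n) K)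
    (hfI : ∀ j, f j ∈ I) (hfhom : ∀ j, (f j).IsHomogeneous k)
    (hgen : ∀ g ∈ I, g ≠ 0 → g.IsHomogeneous k →
      ∃ T : Finset (Fin r), T.Nonempty ∧
        newton g = convexHull ℝ (⋃ j ∈ T, newton (f j)))
    (N : ℕ) : ∀ g ∈ I, g.IsHomogeneous k → (∀ d ∈ g.support, digitWeight (k + 1) d < N) →
      g ∈ Submodule.span K (Set.range f) := by
  induction N with
  | zero =>
    intro g _ _ h
    have hg : g = 0 := MvPolynomial.support_eq_empty.mp
      (Finset.eq_empty_of_forall_notMem fun d hd => Nat.not_lt_zero _ (h d hd))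
    exact hg ▸ Submodule.zero_mem _
  | succ N ih =>
    intro g hgI hg h
    by_cases hex : ∃ d ∈ g.support, digitWeight (k + 1) d = N
    · obtain ⟨d, hd, rfl⟩ := hex
      have hg0 : g ≠ 0 := by
        rintro rfl
        simp at hd
      obtain ⟨T, -, hT⟩ := hgen g hgI hg0 hg
      obtain ⟨j, ⟨e, he, hed⟩, hj⟩ := exists_digitWeight_eq_of_newton_eq (k + 1) hT hd
        fun e he => Nat.le_of_lt_succ (h e he)
      obtain rfl : e = d := digitWeight_injOn ((hfhom j).apply_le_of_mem_support he)
        (hg.apply_le_of_mem_support hd) hed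
      set c := g.coeff e / (f j).coeff e
      have hcfI : c • f j ∈ I := by
        rw [MvPolynomial.smul_eq_C_mul]
        exact I.mul_mem_left _ (hfI j)
      have hhom : (g - c • f j).IsHomogeneous k :=
        (MvPolynomial.homogeneousSubmodule (Fin n) K k).sub_mem hg
          ((MvPolynomial.homogeneousSubmodule (Fin n) K k).smul_mem c (hfhom j))
      have hmem : g - c • f j ∈ Submodule.span K (Set.range f) := by
        refine ih _ (I.sub_mem hgI hcfI) hhom fun a ha => ?_
        have hle : digitWeight (k + 1) a ≤ digitWeight (k + 1) e := by
          by_cases hag : a ∈ g.support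
          · exact Nat.le_of_lt_succ (h a hag)
          · refine hj a ?_
            rw [MvPolynomial.mem_support_iff] at ha ⊢
            intro h0
            simp [MvPolynomial.notMem_support_iff.mp hag, h0] at ha
        refine hle.lt_of_ne fun hae => ?_
        obtain rfl : a = e := digitWeight_injOn (hhom.apply_le_of_mem_support ha)
          (hg.apply_le_of_mem_support hd) hae
        rw [MvPolynomial.mem_support_iff] at ha he
        exact ha (by simp [c, div_mul_cancel₀ _ he])
      rw [← sub_add_cancel g (c • f j)]
      exact Submodule.add_mem _ hmem
        (Submodule.smul_mem _ c (Submodule.subset_span (Set.mem_range_self j)))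
    · push Not at hex
      exact ih g hgI hg fun d hd => (Nat.le_of_lt_succ (h d hd)).lt_of_ne (hex d hd)

/-- If nonzero homogeneous degree-`k` elements `f₁, …, f_r` of a homogeneous ideal `I` are such
that the Newton polytope of every nonzero homogeneous degree-`k` element of `I` is a convex hull
of a union of some of the `New(f j)`, then the `f j` span `I_k`; in particular
`dim_K I_k ≤ r`. -/
theorem newton_generators_span {K : Type*} [Field K] [Infinite K] {n : ℕ}
    (I : Ideal (MvPolynomial (Fin n) K))
    (hI : ∀ g ∈ I, ∀ k : ℕ, MvPolynomial.homogeneousComponent k g ∈ I)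
    (k : ℕ) (r : ℕ) (f : Fin r → MvPolynomial (Fin n) K)
    (hfI : ∀ j, f j ∈ I) (hf0 : ∀ j, f j ≠ 0)
    (hfhom : ∀ j, (f j).IsHomogeneous k)
    (hgen : ∀ g ∈ I, g ≠ 0 → g.IsHomogeneous k →
      ∃ T : Finset (Fin r), T.Nonempty ∧
        newton g = convexHull ℝ (⋃ j ∈ T, newton (f j))) :
    (∀ g ∈ I, g.IsHomogeneous k → g ∈ Submodule.span K (Set.range f)) ∧
      Module.rank K ↥(Submodule.span K (Set.range f)) ≤ r := by
  refine ⟨fun g hgI hg => ?_, ?_⟩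
  · exact mem_span_of_digitWeight_lt I k r f hfI hfhom hgen
      (g.support.sup (digitWeight (k + 1)) + 1) g hgI hg
      fun d hd => Nat.lt_succ_of_le (Finset.le_sup hd)
  · refine (rank_span_le _).trans ?_
    simpa using Cardinal.mk_range_le_lift (f := f)
end

section
/- Let K be an infinite field and I a homogeneous ideal of K[x₁,…,xₙ]. Suppose S is a set of nonzero elements of I such that for every nonzero g ∈ I there exist a nonempty finite family (f_j)_{j∈J} of elements of S and lattice polytopes (Q_j)_{j∈J} with New(g) = convexHull ℝ (⋃_{j∈J} (New(f_j) + Q_j)). Then S generates I as an ideal (every element of I lies in the ideal generated by S). In particular, any Newton basis of I is a generating set of I. -/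
open Pointwise

theorem posSMulStrictMono_lex (n : ℕ) : PosSMulStrictMono ℝ (Lex (Fin n → ℝ)) where
  smul_lt_smul_of_pos_left := by
    rintro a ha x y ⟨i, hlt, hi⟩
    exact ⟨i, fun j hj => congrArg (a * ·) (hlt j hj), mul_lt_mul_of_pos_left hi ha⟩

theorem convex_setOf_toLex_lt {n : ℕ} (v : Fin n → ℝ) : Convex ℝ {x | toLex x < toLex v} :=
  have := posSMulStrictMono_lex n
  (convex_Iio (𝕜 := ℝ) (toLex v)).linear_preimage (toLexLinearEquiv ℝ (Fin n → ℝ)).toLinearMap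

theorem convex_setOf_toLex_le {n : ℕ} (v : Fin n → ℝ) : Convex ℝ {x | toLex x ≤ toLex v} :=
  have := posSMulStrictMono_lex n
  (convex_Iic (𝕜 := ℝ) (toLex v)).linear_preimage (toLexLinearEquiv ℝ (Fin n → ℝ)).toLinearMap

/-- An exponent vector, seen as a point of `ℝⁿ`. -/
def exponentPoint {n : ℕ} (d : Fin n →₀ ℕ) : Fin n → ℝ := fun i => d i

theorem exponentPoint_add {n : ℕ} (d e : Fin n →₀ ℕ) :
    exponentPoint (d + e) = exponentPoint d + exponentPoint e := by
  ext i; simp [exponentPoint]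

theorem exponentPoint_injective {n : ℕ} : Function.Injective (exponentPoint (n := n)) :=
  fun _ _ h => Finsupp.ext fun i => Nat.cast_injective (R := ℝ) (congrFun h i)

theorem toLex_exponentPoint_le_iff {n : ℕ} {d e : Fin n →₀ ℕ} :
    toLex (exponentPoint d) ≤ toLex (exponentPoint e) ↔
      MonomialOrder.lex.toSyn d ≤ MonomialOrder.lex.toSyn e := by
  rw [MonomialOrder.lex_le_iff, ← not_lt, ← not_lt, Finsupp.Lex.lt_iff]
  refine not_congr (exists_congr fun i => and_congr ?_ ?_)
  · exact forall_congr' fun j => forall_congr' fun _ => Nat.cast_inj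
  · exact Nat.cast_lt

theorem IsLatticePolytope.exists_exponents {n : ℕ} {Q : Set (Fin n → ℝ)}
    (hQ : IsLatticePolytope Q) :
    ∃ E : Set (Fin n →₀ ℕ), Q = convexHull ℝ (exponentPoint '' E) := by
  obtain ⟨F, -, hF, rfl⟩ := hQ
  refine ⟨exponentPoint ⁻¹' F, ?_⟩
  rw [Set.image_preimage_eq_of_subset]
  intro x hx
  choose m hm using hF x hx
  exact ⟨Finsupp.equivFunOnFinite.symm m, funext fun i => by simp [exponentPoint, hm]⟩

theorem toLex_le_of_mem_newton {K : Type*} [CommSemiring K] {n : ℕ}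
    {g : MvPolynomial (Fin n) K} {x : Fin n → ℝ} (hx : x ∈ newton g) :
    toLex x ≤ toLex (exponentPoint (MonomialOrder.lex.degree g)) := by
  refine convexHull_min ?_ (convex_setOf_toLex_le _) hx
  rintro _ ⟨d, hd, rfl⟩
  exact toLex_exponentPoint_le_iff.2 (MonomialOrder.le_degree hd)

/-- If the Newton polytope of `g` is generated by those of the `f j`, then the lexicographic
leading monomial of some `f j` divides that of `g`. -/
theorem exists_lex_degree_eq_add {K ι : Type*} [CommSemiring K] {n : ℕ}
    {g : MvPolynomial (Fin n) K} (hg : g ≠ 0) {J : Finset ι} {f : ι → MvPolynomial (Fin n) K}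
    {Q : ι → Set (Fin n → ℝ)} (hQ : ∀ j ∈ J, IsLatticePolytope (Q j))
    (h : newton g = convexHull ℝ (⋃ j ∈ J, (newton (f j) + Q j))) :
    ∃ j ∈ J, ∃ q, MonomialOrder.lex.degree g = q + MonomialOrder.lex.degree (f j) := by
  by_contra! hne
  set v := MonomialOrder.lex.degree g
  have hmem : exponentPoint v ∈ newton g :=
    subset_convexHull ℝ _ ⟨v, MonomialOrder.degree_mem_support hg, rfl⟩
  refine lt_irrefl (toLex (exponentPoint v))
    (convexHull_min ?_ (convex_setOf_toLex_lt (exponentPoint v)) (h ▸ hmem))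
  refine Set.iUnion₂_subset fun j hj => ?_
  obtain ⟨E, hE⟩ := (hQ j hj).exists_exponents
  have hsub : newton (f j) + Q j ⊆ newton g := h ▸
    (Set.subset_iUnion₂ (s := fun j (_ : j ∈ J) => newton (f j) + Q j) j hj).trans
      (subset_convexHull ℝ _)
  have hle {p q : Fin n →₀ ℕ} (hp : p ∈ (f j).support) (hq : q ∈ E) :
      toLex (exponentPoint (p + q)) ≤ toLex (exponentPoint v) := by
    refine toLex_le_of_mem_newton (hsub ?_)
    rw [exponentPoint_add, hE]
    exact Set.add_mem_add (subset_convexHull ℝ _ ⟨p, hp, rfl⟩)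
      (subset_convexHull ℝ _ ⟨q, hq, rfl⟩)
  rw [hE, newton, ← convexHull_add]
  refine convexHull_min ?_ (convex_setOf_toLex_lt _)
  rintro _ ⟨_, ⟨p, hp, rfl⟩, _, ⟨q, hq, rfl⟩, rfl⟩
  change toLex (exponentPoint p + exponentPoint q) < _
  rw [← exponentPoint_add]
  refine lt_of_le_of_ne (hle hp hq) fun heq => hne j hj q ?_
  have hpq : p + q = v := exponentPoint_injective (toLex.injective heq)
  have hf : f j ≠ 0 := by intro h0; simp [h0] at hp
  have hdeg := toLex_exponentPoint_le_iff.1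
    (hle (MonomialOrder.degree_mem_support (m := .lex) hf) hq)
  rw [← hpq, map_add, map_add, add_le_add_iff_right] at hdeg
  rw [← hpq, add_comm,
    MonomialOrder.lex.toSyn.injective (hdeg.antisymm (MonomialOrder.le_degree hp))]

/-- A set of nonzero elements of an ideal generates it as soon as the leading monomial of every
nonzero element of the ideal is divisible by the leading monomial of an element of the set. -/
theorem mem_span_of_degree_eq_add {σ K : Type*} [Field K] (m : MonomialOrder σ)
    {I : Ideal (MvPolynomial σ K)} {S : Set (MvPolynomial σ K)}
    (hS : ∀ f ∈ S, f ∈ I ∧ f ≠ 0)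
    (h : ∀ g ∈ I, g ≠ 0 → ∃ f ∈ S, ∃ q, m.degree g = q + m.degree f) :
    ∀ g ∈ I, g ∈ Ideal.span S := by
  intro g
  induction g using (InvImage.wf (fun g => m.toSyn (m.degree g)) wellFounded_lt).induction with
  | _ g ih =>
    intro hg
    rcases eq_or_ne g 0 with rfl | hg0
    · exact zero_mem _
    obtain ⟨f, hfS, q, hq⟩ := h g hg hg0
    obtain ⟨hfI, hf0⟩ := hS f hfS
    set r := MvPolynomial.monomial q (m.leadingCoeff g / m.leadingCoeff f) * f with hr
    have hrS : r ∈ Ideal.span S := Ideal.mul_mem_left _ _ (Ideal.subset_span hfS)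
    suffices g - r ∈ Ideal.span S by simpa using add_mem this hrS
    rcases eq_or_ne (g - r) 0 with h0 | h0
    · rw [h0]; exact zero_mem _
    refine ih _ ?_ (sub_mem hg (Ideal.mul_mem_left _ _ hfI))
    have hcoeff : (g - r).coeff (m.degree g) = 0 := by
      rw [MvPolynomial.coeff_sub, hr, hq, MvPolynomial.coeff_monomial_mul, ← hq]
      change m.leadingCoeff g - _ * m.leadingCoeff f = 0
      rw [div_mul_cancel₀ _ (m.leadingCoeff_ne_zero_iff.2 hf0), sub_self]
    have hrdeg : m.toSyn (m.degree r) ≤ m.toSyn (m.degree g) := by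
      refine m.degree_mul_le.trans ?_
      rw [hq, map_add, map_add]
      gcongr
      exact m.degree_monomial_le _
    refine lt_of_le_of_ne (m.degree_sub_le.trans (max_le le_rfl hrdeg)) fun heq => ?_
    rw [← m.toSyn.injective heq] at hcoeff
    exact m.coeff_degree_ne_zero_iff.2 h0 hcoeff

/-- Any Newton basis of a homogeneous ideal `I` is a generating set of `I`. -/
theorem newton_basis_generates {K : Type*} [Field K] [Infinite K] {n : ℕ}
    (I : Ideal (MvPolynomial (Fin n) K))
    (hI : ∀ g ∈ I, ∀ k : ℕ, MvPolynomial.homogeneousComponent k g ∈ I)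
    (S : Set (MvPolynomial (Fin n) K))
    (hS : ∀ f ∈ S, f ∈ I ∧ f ≠ 0)
    (hNB : ∀ g ∈ I, g ≠ 0 →
      ∃ (J : Finset ℕ) (f : ℕ → MvPolynomial (Fin n) K) (Q : ℕ → Set (Fin n → ℝ)),
        J.Nonempty ∧ (∀ j ∈ J, f j ∈ S ∧ IsLatticePolytope (Q j)) ∧
        newton g = convexHull ℝ (⋃ j ∈ J, (newton (f j) + Q j))) :
    ∀ g ∈ I, g ∈ Ideal.span S := by
  refine mem_span_of_degree_eq_add MonomialOrder.lex hS fun g hg hg0 => ?_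
  obtain ⟨J, f, Q, -, hfQ, hnewton⟩ := hNB g hg hg0
  obtain ⟨j, hj, q, hq⟩ := exists_lex_degree_eq_add hg0 (fun j hj => (hfQ j hj).2) hnewton
  exact ⟨f j, (hfQ j hj).1, q, hq⟩
end

section
/- Every lattice polytope P in ℝⁿ can be written as a Minkowski sum P = P₁ + P₂ + ⋯ + P_m of finitely many irreducible lattice polytopes, where a lattice polytope is called irreducible if it cannot be written as the Minkowski sum of two lattice polytopes each of which contains more than one point. (This decomposition need not be unique.) -/
open Pointwise

/-- A set contains more than one point. -/
def MoreThanOnePoint {n : ℕ} (P : Set (Fin n → ℝ)) : Prop :=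
  ∃ a ∈ P, ∃ b ∈ P, a ≠ b

/-- An irreducible lattice polytope: one that is not the Minkowski sum of two lattice
polytopes each of which contains more than one point. -/
def IrreduciblePolytope {n : ℕ} (P : Set (Fin n → ℝ)) : Prop :=
  IsLatticePolytope P ∧
    ¬ ∃ Q R : Set (Fin n → ℝ), IsLatticePolytope Q ∧ IsLatticePolytope R ∧
        MoreThanOnePoint Q ∧ MoreThanOnePoint R ∧ P = Q + R

/-- The sum of the coordinates attains a natural number as its maximum on a lattice polytope. -/
theorem IsLatticePolytope.exists_isGreatest {n : ℕ} {P : Set (Fin n → ℝ)}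
    (hP : IsLatticePolytope P) :
    ∃ N : ℕ, IsGreatest ((fun x : Fin n → ℝ => ∑ i, x i) '' P) (N : ℝ) := by
  obtain ⟨F, hne, hF, rfl⟩ := hP
  obtain ⟨a, ha, hmax⟩ := F.exists_max_image (fun x : Fin n → ℝ => ∑ i, x i) hne
  choose m hm using hF a ha
  have hsum : ∑ i, a i = ((∑ i, m i : ℕ) : ℝ) := by simp [hm]
  refine ⟨∑ i, m i, ⟨a, subset_convexHull ℝ _ ha, hsum⟩, ?_⟩
  rintro _ ⟨x, hx, rfl⟩
  rw [← hsum]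
  have hlin : IsLinearMap ℝ (fun x : Fin n → ℝ => ∑ i, x i) :=
    ⟨fun x y => by simp [Finset.sum_add_distrib], fun c x => by simp [Finset.mul_sum]⟩
  exact convexHull_min (t := {x : Fin n → ℝ | ∑ i, x i ≤ ∑ i, a i}) hmax
    (convex_halfSpace_le hlin _) hx

/-- Points of a lattice polytope have nonnegative coordinates. -/
theorem IsLatticePolytope.nonneg_s4 {n : ℕ} {P : Set (Fin n → ℝ)}
    (hP : IsLatticePolytope P) {x : Fin n → ℝ} (hx : x ∈ P) : 0 ≤ x := by
  obtain ⟨F, -, hF, rfl⟩ := hP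
  refine convexHull_min (t := Set.Ici 0) (fun y hy i => ?_) (convex_Ici 0) hx
  obtain ⟨m, hm⟩ := hF y hy i
  simp [hm]

/-- On a lattice polytope with more than one point the maximal coordinate sum is positive. -/
theorem IsLatticePolytope.pos_of_isGreatest {n : ℕ} {P : Set (Fin n → ℝ)}
    (hP : IsLatticePolytope P) (hP' : MoreThanOnePoint P) {N : ℕ}
    (hN : IsGreatest ((fun x : Fin n → ℝ => ∑ i, x i) '' P) (N : ℝ)) : 0 < N := by
  by_contra! h
  obtain rfl : N = 0 := by omega
  have hzero : ∀ x ∈ P, x = 0 := fun x hx => by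
    have hle : ∑ i, x i ≤ 0 := by simpa using hN.2 ⟨x, hx, rfl⟩
    have hnn := hP.nonneg_s4 hx
    exact (Fintype.sum_eq_zero_iff_of_nonneg hnn).1
      (hle.antisymm (Finset.sum_nonneg fun i _ => hnn i))
  obtain ⟨a, ha, b, hb, hab⟩ := hP'
  exact hab ((hzero a ha).trans (hzero b hb).symm)

/-- The maximal coordinate sum is additive under Minkowski sums. -/
theorem isGreatest_sum_image_add {n : ℕ} {Q R : Set (Fin n → ℝ)} {a b : ℝ}
    (hQ : IsGreatest ((fun x : Fin n → ℝ => ∑ i, x i) '' Q) a)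
    (hR : IsGreatest ((fun x : Fin n → ℝ => ∑ i, x i) '' R) b) :
    IsGreatest ((fun x : Fin n → ℝ => ∑ i, x i) '' (Q + R)) (a + b) := by
  obtain ⟨⟨q, hq, rfl⟩, hQ⟩ := hQ
  obtain ⟨⟨r, hr, rfl⟩, hR⟩ := hR
  refine ⟨⟨q + r, Set.add_mem_add hq hr, by simp [Finset.sum_add_distrib]⟩, ?_⟩
  rintro _ ⟨_, ⟨x, hx, y, hy, rfl⟩, rfl⟩
  simpa [Finset.sum_add_distrib] using add_le_add (hQ ⟨x, hx, rfl⟩) (hR ⟨y, hy, rfl⟩)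

/-- Every lattice polytope is a finite Minkowski sum of irreducible lattice polytopes. -/
theorem exists_irreducible_minkowski_decomposition {n : ℕ} (P : Set (Fin n → ℝ))
    (hP : IsLatticePolytope P) :
    ∃ (m : ℕ) (Ps : Fin (m + 1) → Set (Fin n → ℝ)),
      (∀ i, IrreduciblePolytope (Ps i)) ∧ P = ∑ i, Ps i := by
  obtain ⟨N, hN⟩ := hP.exists_isGreatest
  induction N using Nat.strong_induction_on generalizing P with
  | _ N ih =>
    by_cases hirr : IrreduciblePolytope P
    · exact ⟨0, fun _ => P, fun _ => hirr, by simp⟩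
    obtain ⟨Q, R, hQ, hR, hQ', hR', rfl⟩ := not_not.1 fun h => hirr ⟨hP, h⟩
    obtain ⟨a, ha⟩ := hQ.exists_isGreatest
    obtain ⟨b, hb⟩ := hR.exists_isGreatest
    have hsum : N = a + b := by
      exact_mod_cast hN.unique (isGreatest_sum_image_add ha hb)
    have ha_pos := hQ.pos_of_isGreatest hQ' ha
    have hb_pos := hR.pos_of_isGreatest hR' hb
    obtain ⟨k, Qs, hQs, hQsum⟩ := ih a (by omega) Q hQ ha
    obtain ⟨l, Rs, hRs, hRsum⟩ := ih b (by omega) R hR hb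
    refine ⟨k + 1 + l, Fin.append (m := k + 1) (n := l + 1) Qs Rs, fun i => ?_, ?_⟩
    · refine Fin.addCases (m := k + 1) (n := l + 1) (fun j => ?_) (fun j => ?_) i
      · rw [Fin.append_left]
        exact hQs j
      · rw [Fin.append_right]
        exact hRs j
    · refine Eq.trans ?_ (Fin.sum_univ_add (Fin.append Qs Rs)).symm
      simp only [Fin.append_left, Fin.append_right]
      rw [← hQsum, ← hRsum]
end

section
/- Fix lattice polytopes P₁,…,P_r, U, V in ℝⁿ and set W = U + V. Let M_U be the set of r-tuples (Y₁,…,Y_r) of lattice polytopes with U = convexHull ℝ (⋃_{i=1}^r (P_i + Y_i)), and let M_{W,V} be the set of r-tuples (Y₁,…,Y_r) of lattice polytopes with W = convexHull ℝ (⋃_{i=1}^r (P_i + Y_i)) such that each Y_i has V as a Minkowski summand (i.e. Y_i = V + Y_i′ for some lattice polytope Y_i′). If M_U is nonempty, then M_{W,V} is nonempty and for each coordinate i ∈ {1,…,r}: convexHull ℝ (⋃_{(Y₁,…,Y_r)∈M_{W,V}} Y_i) = V + convexHull ℝ (⋃_{(Y₁,…,Y_r)∈M_U} Y_i); that is, the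 canonical solution of the equation for W with respect to V equals V plus the canonical solution of the equation for U. -/
open Pointwise

/-- Order cancellation for Minkowski sums: a nonempty compact summand can be cancelled from an
inclusion whose right-hand side is closed and convex. -/
theorem subset_of_add_subset_add_left {E : Type*} [AddCommGroup E] [Module ℝ E]
    [TopologicalSpace E] [IsTopologicalAddGroup E] [ContinuousSMul ℝ E] [LocallyConvexSpace ℝ E]
    {A B C : Set E} (hC : IsCompact C) (hCne : C.Nonempty) (hBc : Convex ℝ B) (hB : IsClosed B)
    (h : C + A ⊆ C + B) : A ⊆ B := by
  intro a ha
  by_contra hab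
  obtain ⟨f, u, hfB, hfa⟩ := geometric_hahn_banach_closed_point hBc hB hab
  obtain ⟨c, hc, hmax⟩ := hC.exists_isMaxOn hCne f.continuous.continuousOn
  obtain ⟨c', hc', b, hb, hcb⟩ := Set.mem_add.1 (h (Set.add_mem_add hc ha))
  have hsum := congrArg f hcb
  rw [map_add, map_add] at hsum
  have hle : f c' ≤ f c := hmax hc'
  linarith [hfB b hb]

namespace IsLatticePolytope

variable {n : ℕ} {P Q : Set (Fin n → ℝ)}

theorem exists_finite_convexHull (hP : IsLatticePolytope P) :
    ∃ F : Set (Fin n → ℝ), F.Finite ∧ P = convexHull ℝ F := by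
  obtain ⟨F, -, -, hF⟩ := hP
  exact ⟨F, F.finite_toSet, hF⟩

theorem add_convexHull (hP : IsLatticePolytope P) (s : Set (Fin n → ℝ)) :
    P + convexHull ℝ s = convexHull ℝ (P + s) := by
  rw [convexHull_add, hP.convex.convexHull_eq]

end IsLatticePolytope

theorem isClosed_convexHull_iUnion_of_isLatticePolytope {n : ℕ} {ι : Type*} [Finite ι]
    {P : ι → Set (Fin n → ℝ)} (hP : ∀ i, IsLatticePolytope (P i)) :
    IsClosed (convexHull ℝ (⋃ i, P i)) := by
  choose F hF hPF using fun i => (hP i).exists_finite_convexHull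
  have h : convexHull ℝ (⋃ i, P i) = convexHull ℝ (⋃ i, F i) := by
    refine Set.Subset.antisymm (convexHull_min (Set.iUnion_subset fun i => ?_)
      (convex_convexHull ℝ _)) (convexHull_mono (Set.iUnion_mono fun i => ?_))
    · rw [hPF i]
      exact convexHull_mono (Set.subset_iUnion F i)
    · rw [hPF i]
      exact subset_convexHull ℝ _
  rw [h]
  exact ((Set.finite_iUnion hF).isCompact_convexHull ℝ).isClosed

/-- Translating all coordinates by a lattice polytope `V` translates `⊕ᵢ (Pᵢ ⊙ Yᵢ)` by `V`. -/
theorem IsLatticePolytope.convexHull_iUnion_add_add {n : ℕ} {ι : Type*} {V : Set (Fin n → ℝ)}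
    (hV : IsLatticePolytope V) (P Y : ι → Set (Fin n → ℝ)) :
    convexHull ℝ (⋃ i, (P i + (V + Y i))) = V + convexHull ℝ (⋃ i, (P i + Y i)) := by
  rw [hV.add_convexHull, Set.add_iUnion]
  simp only [add_left_comm]

/-- If `W = U + V` and the equation for `U` has a solution, then the canonical solution of the
equation for `W` with respect to `V` equals `V` plus the canonical solution of the equation
for `U` (coordinatewise). -/
theorem canonical_solution_translate {n r : ℕ}
    (P : Fin r → Set (Fin n → ℝ)) (U V W : Set (Fin n → ℝ))
    (hP : ∀ i, IsLatticePolytope (P i)) (hU : IsLatticePolytope U)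
    (hV : IsLatticePolytope V) (hW : W = U + V)
    (MU : Set (Fin r → Set (Fin n → ℝ)))
    (hMU : MU = {Y | (∀ i, IsLatticePolytope (Y i)) ∧
      U = convexHull ℝ (⋃ i, (P i + Y i))})
    (MWV : Set (Fin r → Set (Fin n → ℝ)))
    (hMWV : MWV = {Y | (∀ i, ∃ Y' : Set (Fin n → ℝ), IsLatticePolytope Y' ∧ Y i = V + Y') ∧
      W = convexHull ℝ (⋃ i, (P i + Y i))})
    (hne : MU.Nonempty) :
    MWV.Nonempty ∧
      ∀ i : Fin r,
        convexHull ℝ (⋃ Y ∈ MWV, Y i) = V + convexHull ℝ (⋃ Y ∈ MU, Y i) := by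
  have himage : MWV = (fun Y i => V + Y i) '' MU := by
    subst hMU hMWV
    ext Y
    constructor
    · rintro ⟨hY, hWY⟩
      choose Z hZ hYZ using hY
      obtain rfl : Y = fun i => V + Z i := funext hYZ
      refine ⟨Z, ⟨hZ, ?_⟩, rfl⟩
      rw [hV.convexHull_iUnion_add_add, hW, add_comm U V] at hWY
      exact Set.Subset.antisymm
        (subset_of_add_subset_add_left hV.isCompact hV.nonempty (convex_convexHull ℝ _)
          (isClosed_convexHull_iUnion_of_isLatticePolytope fun i => (hP i).add (hZ i)) hWY.subset)
        (subset_of_add_subset_add_left hV.isCompact hV.nonempty hU.convex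
          hU.isCompact.isClosed hWY.superset)
    · rintro ⟨Z, ⟨hZ, hUZ⟩, rfl⟩
      refine ⟨fun i => ⟨Z i, hZ i, rfl⟩, ?_⟩
      rw [hV.convexHull_iUnion_add_add, ← hUZ, hW, add_comm]
  refine ⟨himage ▸ hne.image _, fun i => ?_⟩
  rw [himage, Set.biUnion_image, hV.add_convexHull, Set.add_iUnion₂]
end

section
/- Let K be an infinite field, n ≥ 2, and let I be the ideal of K[x₁,…,xₙ] generated by x₁ − x₂, x₂ − x₃, …, x_{n−1} − xₙ. Let N₁ = {New(f) : f ∈ I homogeneous of degree 1, f ≠ 0} and let e₁,…,eₙ be the standard basis vectors of ℝⁿ. Then: (i) N₁ = {convexHull ℝ {e_i : i ∈ S} : S ⊆ {1,…,n}, |S| ≥ 2}; (ii) the semigroup (N₁, ⊕) is minimally generated by the binom(n,2) segments C_{i,j} = convexHull ℝ {e_i, e_j} (i < j): every element of N₁ is a ⊕-combination (iterated convex hull of unions) of finitely many of the C_{i,j}, and no C_{i,j} is a ⊕-combination of elements of N₁ \ {C_{i,j}}. In particular, the first Newton–Hilbert coefficient of I equals binom(n,2). -/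
open Pointwise

/-- The `i`-th standard basis vector of `ℝⁿ`. -/
noncomputable def stdVec {n : ℕ} (i : Fin n) : Fin n → ℝ :=
  fun j => if j = i then 1 else 0

/-- `P` is a ⊕-combination (iterated convex hull of unions) of finitely many elements of `G`. -/
def OplusCombination {n : ℕ} (G : Set (Set (Fin n → ℝ))) (P : Set (Fin n → ℝ)) : Prop :=
  ∃ T : Finset (Set (Fin n → ℝ)), T.Nonempty ∧ ↑T ⊆ G ∧
    P = convexHull ℝ (⋃ Q ∈ T, Q)

theorem mem_convexHull_stdVec_image_iff {n : ℕ} {i : Fin n} {S : Set (Fin n)} :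
    stdVec i ∈ convexHull ℝ (stdVec '' S) ↔ i ∈ S := by
  refine ⟨fun h => ?_, fun h => subset_convexHull ℝ _ ⟨i, h, rfl⟩⟩
  by_contra hi
  have hconv : Convex ℝ {x : Fin n → ℝ | x i = 0} := by
    intro x hx y hy a b _ _ _
    simp only [Set.mem_ofPred_eq] at hx hy ⊢
    simp [hx, hy]
  have hsub : stdVec '' S ⊆ {x : Fin n → ℝ | x i = 0} := by
    rintro _ ⟨j, hj, rfl⟩
    have hij : i ≠ j := by
      rintro rfl
      exact hi hj
    simp [stdVec, hij]
  have h0 := convexHull_min hsub hconv h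
  simp [stdVec] at h0

theorem subset_of_convexHull_stdVec_image_subset {n : ℕ} {S T : Set (Fin n)}
    (h : convexHull ℝ (stdVec '' S) ⊆ convexHull ℝ (stdVec '' T)) : S ⊆ T := fun _ hi =>
  mem_convexHull_stdVec_image_iff.1 (h (mem_convexHull_stdVec_image_iff.2 hi))

theorem convexHull_stdVec_image_injective {n : ℕ} :
    Function.Injective fun S : Finset (Fin n) => convexHull ℝ (stdVec '' (S : Set (Fin n))) := by
  intro S T h
  exact Finset.coe_injective (Set.Subset.antisymm
    (subset_of_convexHull_stdVec_image_subset h.subset)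
    (subset_of_convexHull_stdVec_image_subset h.symm.subset))

theorem setOf_segments_eq_image {n : ℕ} :
    {P : Set (Fin n → ℝ) | ∃ i j : Fin n, i < j ∧ P = convexHull ℝ {stdVec i, stdVec j}} =
      (fun S : Finset (Fin n) => convexHull ℝ (stdVec '' (S : Set (Fin n)))) ''
        ((Finset.univ : Finset (Fin n)).powersetCard 2 : Set (Finset (Fin n))) := by
  ext P
  simp only [Set.mem_ofPred_eq, Set.mem_image, Finset.mem_coe, Finset.mem_powersetCard,
    Finset.subset_univ, true_and]
  constructor
  · rintro ⟨i, j, hij, rfl⟩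
    exact ⟨{i, j}, Finset.card_pair hij.ne, by simp [Set.image_pair]⟩
  · rintro ⟨S, hS, rfl⟩
    obtain ⟨a, b, hab, rfl⟩ := Finset.card_eq_two.1 hS
    rcases lt_or_gt_of_ne hab with h | h
    · exact ⟨a, b, h, by simp [Set.image_pair]⟩
    · exact ⟨b, a, h, by simp [Set.image_pair, Set.pair_comm]⟩

theorem oplusCombination_segments {n : ℕ} (S : Finset (Fin n)) (hS : 2 ≤ S.card) :
    OplusCombination {P | ∃ i j : Fin n, i < j ∧ P = convexHull ℝ {stdVec i, stdVec j}}
      (convexHull ℝ (stdVec '' (S : Set (Fin n)))) := by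
  classical
  rw [setOf_segments_eq_image]
  refine ⟨(S.powersetCard 2).image fun U : Finset (Fin n) => convexHull ℝ (stdVec '' (U : Set (Fin n))),
    (Finset.powersetCard_nonempty.2 hS).image _, ?_, ?_⟩
  · rw [Finset.coe_image]
    exact Set.image_mono (Finset.coe_subset.2 (Finset.powersetCard_mono (Finset.subset_univ S)))
  · apply Set.Subset.antisymm
    · apply convexHull_mono
      rintro _ ⟨i, hi, rfl⟩
      obtain ⟨j, hj, hji⟩ := Finset.exists_mem_ne hS i
      simp only [Set.mem_iUnion]
      refine ⟨_, Finset.mem_image_of_mem _ (Finset.mem_powersetCard.2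
        ⟨Finset.insert_subset hi (Finset.singleton_subset_iff.2 hj),
          Finset.card_pair hji.symm⟩), ?_⟩
      exact mem_convexHull_stdVec_image_iff.2 (by simp)
    · refine convexHull_min ?_ (convex_convexHull ℝ _)
      refine Set.iUnion₂_subset fun Q hQ => ?_
      obtain ⟨U, hU, rfl⟩ := Finset.mem_image.1 hQ
      exact convexHull_mono (Set.image_mono (Finset.mem_powersetCard.1 hU).1)

theorem not_oplusCombination_segment {n : ℕ} (i j : Fin n) :
    ¬ OplusCombination ({P | ∃ S : Finset (Fin n), 2 ≤ S.card ∧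
        P = convexHull ℝ (stdVec '' (S : Set (Fin n)))} \ {convexHull ℝ {stdVec i, stdVec j}})
      (convexHull ℝ {stdVec i, stdVec j}) := by
  rintro ⟨T, ⟨Q, hQ⟩, hT, h⟩
  obtain ⟨⟨S, hS, rfl⟩, hne⟩ := hT hQ
  have hpair : ({stdVec i, stdVec j} : Set (Fin n → ℝ)) =
      stdVec '' (({i, j} : Finset (Fin n)) : Set (Fin n)) := by simp [Set.image_pair]
  have hsub : convexHull ℝ (stdVec '' (S : Set (Fin n))) ⊆ convexHull ℝ {stdVec i, stdVec j} := by
    rw [h]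
    exact (Set.subset_biUnion_of_mem (u := fun Q : Set (Fin n → ℝ) => Q) hQ).trans
      (subset_convexHull ℝ _)
  rw [hpair] at hsub hne
  have hSij : S ⊆ {i, j} :=
    Finset.coe_subset.1 (subset_of_convexHull_stdVec_image_subset hsub)
  exact hne (by rw [Finset.eq_of_subset_of_card_le hSij (Finset.card_le_two.trans hS)]; rfl)

theorem support_eq_image_single_of_isHomogeneous_one {σ K : Type*} [CommSemiring K]
    {f : MvPolynomial σ K} (hf : f.IsHomogeneous 1) :
    (f.support : Set (σ →₀ ℕ)) =
      (fun i => Finsupp.single i 1) '' {i | f.coeff (Finsupp.single i 1) ≠ 0} := by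
  ext d
  simp only [Finset.mem_coe, MvPolynomial.mem_support_iff, Set.mem_image, Set.mem_ofPred_eq]
  constructor
  · intro hd
    have hdeg : d.degree = 1 := by
      rw [Finsupp.degree_eq_weight_one]
      exact hf hd
    obtain ⟨i, rfl⟩ := Finsupp.range_single_one.superset hdeg
    exact ⟨i, hd, rfl⟩
  · rintro ⟨i, hi, rfl⟩
    exact hi

theorem newton_of_isHomogeneous_one {K : Type*} [CommSemiring K] {n : ℕ}
    {f : MvPolynomial (Fin n) K} (hf : f.IsHomogeneous 1) :
    newton f = convexHull ℝ (stdVec '' {i | f.coeff (Finsupp.single i 1) ≠ 0}) := by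
  have hvec : ∀ i : Fin n,
      (fun j => ((Finsupp.single i 1 : Fin n →₀ ℕ) j : ℝ)) = stdVec i := by
    intro i
    funext j
    simp [stdVec, Finsupp.single_apply, eq_comm]
  rw [newton, support_eq_image_single_of_isHomogeneous_one hf, Set.image_image]
  simp only [hvec]

theorem eval_one_eq_sum_of_isHomogeneous_one {σ K : Type*} [Fintype σ] [CommSemiring K]
    {f : MvPolynomial σ K} (hf : f.IsHomogeneous 1) :
    MvPolynomial.eval 1 f = ∑ i, f.coeff (Finsupp.single i 1) := by
  classical
  have hsub : f.support ⊆ Finset.univ.image fun i : σ => Finsupp.single i 1 := by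
    rw [← Finset.coe_subset, support_eq_image_single_of_isHomogeneous_one hf]
    rintro _ ⟨i, _, rfl⟩
    simp
  have heval : MvPolynomial.eval 1 f = ∑ d ∈ f.support, f.coeff d := by
    simp [MvPolynomial.eval_eq]
  rw [heval, Finset.sum_subset hsub fun d _ hd => MvPolynomial.notMem_support_iff.1 hd,
    Finset.sum_image fun i _ j _ h => Finsupp.single_left_injective one_ne_zero h]

theorem exists_sum_eq_zero_support_eq {ι K : Type*} [Fintype ι] [Field K] [Infinite K]
    {S : Finset ι} (hS : 2 ≤ S.card) :
    ∃ c : ι → K, ∑ i, c i = 0 ∧ ∀ i, c i ≠ 0 ↔ i ∈ S := by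
  classical
  obtain ⟨a, ha, b, hb, hab⟩ := Finset.one_lt_card.1 hS
  set U := (S.erase a).erase b with hU
  obtain ⟨t, ht⟩ := Infinite.exists_notMem_finset ({0, -(U.card : K)} : Finset K)
  simp only [Finset.mem_insert, Finset.mem_singleton, not_or] at ht
  have haU : a ∉ U := by simp [hU]
  have hbU : b ∉ U := by simp [hU]
  refine ⟨fun i => (if i = a then t else 0) + (if i = b then -(U.card : K) - t else 0) +
    (if i ∈ U then 1 else 0), ?_, fun i => ?_⟩
  · simp [Finset.sum_add_distrib]
  · by_cases hia : i = a
    · subst hia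
      simp [hab, haU, ht.1, ha]
    · by_cases hib : i = b
      · subst hib
        simp only [hia, hbU, hb, if_true, if_false, iff_true, zero_add, add_zero]
        exact fun h => ht.2 (sub_eq_zero.1 h).symm
      · simp [hia, hib, hU]

theorem X_sub_X_zero_mem_span {K : Type*} [CommRing K] {n : ℕ} (hn : 0 < n) (i : Fin n) :
    (MvPolynomial.X i - MvPolynomial.X ⟨0, hn⟩ : MvPolynomial (Fin n) K) ∈
      Ideal.span (Set.range fun i : Fin (n - 1) =>
        (MvPolynomial.X ⟨i.val, by have := i.isLt; omega⟩ : MvPolynomial (Fin n) K) -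
          MvPolynomial.X ⟨i.val + 1, by have := i.isLt; omega⟩) := by
  obtain ⟨k, hk⟩ := i
  induction k with
  | zero => simp
  | succ k ih =>
    have h := Ideal.sub_mem _ (ih (by omega)) (Ideal.subset_span ⟨⟨k, by omega⟩, rfl⟩)
    simpa using h

theorem sum_smul_X_mem_span {K : Type*} [CommRing K] {n : ℕ} (hn : 0 < n) {c : Fin n → K}
    (hc : ∑ i, c i = 0) :
    (∑ i, MvPolynomial.C (c i) * MvPolynomial.X i : MvPolynomial (Fin n) K) ∈
      Ideal.span (Set.range fun i : Fin (n - 1) =>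
        (MvPolynomial.X ⟨i.val, by have := i.isLt; omega⟩ : MvPolynomial (Fin n) K) -
          MvPolynomial.X ⟨i.val + 1, by have := i.isLt; omega⟩) := by
  have h : (∑ i, MvPolynomial.C (c i) * MvPolynomial.X i : MvPolynomial (Fin n) K) =
      ∑ i, MvPolynomial.C (c i) * (MvPolynomial.X i - MvPolynomial.X ⟨0, hn⟩) := by
    simp only [mul_sub, Finset.sum_sub_distrib, ← Finset.sum_mul, ← map_sum, hc, map_zero,
      zero_mul, sub_zero]
  rw [h]
  exact Ideal.sum_mem _ fun i _ => Ideal.mul_mem_left _ _ (X_sub_X_zero_mem_span hn i)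

theorem eval_one_eq_zero_of_mem_span {K : Type*} [CommRing K] {n : ℕ}
    {f : MvPolynomial (Fin n) K}
    (hf : f ∈ Ideal.span (Set.range fun i : Fin (n - 1) =>
        (MvPolynomial.X ⟨i.val, by have := i.isLt; omega⟩ : MvPolynomial (Fin n) K) -
          MvPolynomial.X ⟨i.val + 1, by have := i.isLt; omega⟩)) :
    MvPolynomial.eval 1 f = 0 := by
  rw [← RingHom.mem_ker]
  refine Ideal.span_le.2 ?_ hf
  rintro _ ⟨i, rfl⟩
  simp [RingHom.mem_ker]

theorem newton_degree_one_eq {K : Type*} [Field K] [Infinite K] {n : ℕ} (hn : 0 < n) :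
    {P | ∃ f : MvPolynomial (Fin n) K,
      f ∈ Ideal.span (Set.range fun i : Fin (n - 1) =>
        (MvPolynomial.X ⟨i.val, by have := i.isLt; omega⟩ : MvPolynomial (Fin n) K) -
          MvPolynomial.X ⟨i.val + 1, by have := i.isLt; omega⟩) ∧
      f ≠ 0 ∧ f.IsHomogeneous 1 ∧ P = newton f} =
    {P | ∃ S : Finset (Fin n), 2 ≤ S.card ∧ P = convexHull ℝ (stdVec '' (S : Set (Fin n)))} := by
  classical
  ext P
  constructor
  · rintro ⟨f, hfI, hf0, hf, rfl⟩
    set S : Finset (Fin n) := {i | f.coeff (Finsupp.single i 1) ≠ 0} with hS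
    refine ⟨S, ?_, by rw [newton_of_isHomogeneous_one hf]; simp [hS]⟩
    have hsum : ∑ i ∈ S, f.coeff (Finsupp.single i 1) = 0 := by
      rw [hS, Finset.sum_filter_ne_zero, ← eval_one_eq_sum_of_isHomogeneous_one hf]
      exact eval_one_eq_zero_of_mem_span hfI
    have hne : S.Nonempty := by
      have h := Finset.coe_nonempty.2 (MvPolynomial.support_nonempty.2 hf0)
      rw [support_eq_image_single_of_isHomogeneous_one hf, Set.image_nonempty] at h
      obtain ⟨i, hi⟩ := h
      exact ⟨i, by simpa [hS] using hi⟩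
    by_contra! hlt
    obtain ⟨i, hi⟩ := Finset.card_eq_one.1 (show S.card = 1 by have := hne.card_pos; omega)
    have hiS : i ∈ S := by simp [hi]
    rw [hi, Finset.sum_singleton] at hsum
    exact (Finset.mem_filter.1 hiS).2 hsum
  · rintro ⟨S, hS, rfl⟩
    obtain ⟨c, hc, hcS⟩ := exists_sum_eq_zero_support_eq (K := K) hS
    set f : MvPolynomial (Fin n) K := ∑ i, MvPolynomial.C (c i) * MvPolynomial.X i with hf
    have hcoeff : ∀ i, f.coeff (Finsupp.single i 1) = c i := by
      intro i
      simp [hf, MvPolynomial.coeff_sum, MvPolynomial.coeff_C_mul, MvPolynomial.coeff_X,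
        Finsupp.single_left_inj]
    have hhom : f.IsHomogeneous 1 :=
      MvPolynomial.IsHomogeneous.sum _ _ _ fun i _ => MvPolynomial.isHomogeneous_C_mul_X _ _
    refine ⟨f, sum_smul_X_mem_span hn hc, ?_, hhom, ?_⟩
    · obtain ⟨i, hi⟩ := Finset.card_pos.1 (by omega : 0 < S.card)
      intro h0
      apply (hcS i).2 hi
      rw [← hcoeff, h0, MvPolynomial.coeff_zero]
    · rw [newton_of_isHomogeneous_one hhom]
      simp only [hcoeff, hcS, Finset.setOfPred_mem]

/-- Degree one part of the Newton semimodule of the toric ideal of the root lattice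
`A_{n-1}`: its description and its minimal generation by the segments `C_{i,j}`,
whose number is `binom(n,2)`. -/
theorem newton_semimodule_root_lattice_A {K : Type*} [Field K] [Infinite K]
    (n : ℕ) (hn : 2 ≤ n)
    (I : Ideal (MvPolynomial (Fin n) K))
    (hI : I = Ideal.span (Set.range fun i : Fin (n - 1) =>
      (MvPolynomial.X ⟨i.val, by have := i.isLt; omega⟩ : MvPolynomial (Fin n) K) -
        MvPolynomial.X ⟨i.val + 1, by have := i.isLt; omega⟩))
    (N₁ : Set (Set (Fin n → ℝ)))
    (hN₁ : N₁ = {P | ∃ f : MvPolynomial (Fin n) K,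
      f ∈ I ∧ f ≠ 0 ∧ f.IsHomogeneous 1 ∧ P = newton f})
    (Cseg : Set (Set (Fin n → ℝ)))
    (hC : Cseg = {P | ∃ i j : Fin n, i < j ∧
      P = convexHull ℝ {stdVec i, stdVec j}}) :
    N₁ = {P | ∃ S : Finset (Fin n), 2 ≤ S.card ∧
        P = convexHull ℝ (stdVec '' ↑S)} ∧
    (∀ P ∈ N₁, OplusCombination Cseg P) ∧
    (∀ i j : Fin n, i < j →
      ¬ OplusCombination (N₁ \ {convexHull ℝ {stdVec i, stdVec j}})
        (convexHull ℝ {stdVec i, stdVec j})) ∧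
    Cseg.ncard = n.choose 2 := by
  subst hI hN₁ hC
  rw [newton_degree_one_eq (by omega)]
  refine ⟨rfl, ?_, fun i j _ => not_oplusCombination_segment i j, ?_⟩
  · rintro P ⟨S, hS, rfl⟩
    exact oplusCombination_segments S hS
  · rw [setOf_segments_eq_image, Set.ncard_image_of_injective _ convexHull_stdVec_image_injective,
      Set.ncard_coe_finset, Finset.card_powersetCard, Finset.card_univ, Fintype.card_fin]
end

section
/- Let P₁,…,P_r be lattice polytopes in ℝⁿ. If (Q₁,…,Q_r) and (R₁,…,R_r) are syzygies of (P₁,…,P_r), then (Q₁ ⊕ R₁,…,Q_r ⊕ R_r) is a syzygy of (P₁,…,P_r). Moreover, for every element R of the polytope semiring (R = ∅ or R a lattice polytope), (R + Q₁,…,R + Q_r) is a syzygy of (P₁,…,P_r). Hence the set of syzygies of (P₁,…,P_r) is a semimodule over the polytope semiring. -/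
open Pointwise

/-- An element of the polytope semiring: either the empty set (the zero element)
or a lattice polytope. -/
def PolytopeSemiringElt {n : ℕ} (Q : Set (Fin n → ℝ)) : Prop :=
  Q = ∅ ∨ IsLatticePolytope Q

/-- `(Q₁, …, Q_r)` is a syzygy of the tuple of lattice polytopes `(P₁, …, P_r)`:
each `Qᵢ` is a polytope-semiring element and every extreme point of the associated polytope
`W = convexHull ℝ (⋃ i, Pᵢ + Qᵢ)` lies in `Pᵢ + Qᵢ` for at least two indices `i`. -/
def IsSyzygy {n r : ℕ} (P Q : Fin r → Set (Fin n → ℝ)) : Prop :=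
  (∀ i, PolytopeSemiringElt (Q i)) ∧
    ∀ v ∈ Set.extremePoints ℝ (convexHull ℝ (⋃ i, (P i + Q i))),
      ∃ i j : Fin r, i ≠ j ∧ v ∈ P i + Q i ∧ v ∈ P j + Q j

theorem IsLatticePolytope.convex_s9 {n : ℕ} {P : Set (Fin n → ℝ)} (hP : IsLatticePolytope P) :
    Convex ℝ P := by
  obtain ⟨F, -, -, rfl⟩ := hP
  exact convex_convexHull ℝ _

theorem PolytopeSemiringElt.convex_s9 {n : ℕ} {Q : Set (Fin n → ℝ)} (hQ : PolytopeSemiringElt Q) :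
    Convex ℝ Q := by
  rcases hQ with rfl | hQ
  · exact convex_empty
  · exact hQ.convex_s9

theorem PolytopeSemiringElt.convexHull_union {n : ℕ} {Q R : Set (Fin n → ℝ)}
    (hQ : PolytopeSemiringElt Q) (hR : PolytopeSemiringElt R) :
    PolytopeSemiringElt (convexHull ℝ (Q ∪ R)) := by
  classical
  rcases hQ with rfl | hQ
  · rwa [Set.empty_union, hR.convex_s9.convexHull_eq]
  rcases hR with rfl | hR
  · rw [Set.union_empty, hQ.convex_s9.convexHull_eq]
    exact Or.inr hQ
  obtain ⟨F, hF, hFn, rfl⟩ := hQ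
  obtain ⟨G, -, hGn, rfl⟩ := hR
  refine Or.inr ⟨F ∪ G, hF.mono Finset.subset_union_left, fun x hx => ?_, ?_⟩
  · rcases Finset.mem_union.1 hx with hx | hx
    · exact hFn x hx
    · exact hGn x hx
  · rw [Finset.coe_union, convexHull_convexHull_union_left, convexHull_convexHull_union_right]

theorem PolytopeSemiringElt.add {n : ℕ} {Q R : Set (Fin n → ℝ)}
    (hQ : PolytopeSemiringElt Q) (hR : PolytopeSemiringElt R) :
    PolytopeSemiringElt (Q + R) := by
  classical
  rcases hQ with rfl | ⟨F, hF, hFn, rfl⟩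
  · exact Or.inl Set.empty_add
  rcases hR with rfl | ⟨G, hG, hGn, rfl⟩
  · exact Or.inl Set.add_empty
  refine Or.inr ⟨F + G, hF.add hG, fun x hx i => ?_, ?_⟩
  · obtain ⟨a, ha, b, hb, rfl⟩ := Finset.mem_add.1 hx
    obtain ⟨k, hk⟩ := hFn a ha i
    obtain ⟨l, hl⟩ := hGn b hb i
    exact ⟨k + l, by simp [hk, hl]⟩
  · rw [Finset.coe_add, convexHull_add]

theorem mem_extremePoints_of_add_mem_extremePoints {E : Type*} [AddCommGroup E] [Module ℝ E]
    {A B : Set E} {x w : E} (hx : x ∈ A) (hw : w ∈ B)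
    (h : x + w ∈ Set.extremePoints ℝ (A + B)) : w ∈ Set.extremePoints ℝ B :=
  ⟨hw, fun _ ha _ hb hab => add_left_cancel <|
    h.2 (Set.add_mem_add hx ha) (Set.add_mem_add hx hb) ((mem_openSegment_translate ℝ x).2 hab)⟩

theorem IsSyzygy.exists_ne_of_mem_extremePoints {n r : ℕ} {P Q : Fin r → Set (Fin n → ℝ)}
    (hQ : IsSyzygy P Q) {W : Set (Fin n → ℝ)} {v : Fin n → ℝ}
    (hv : v ∈ Set.extremePoints ℝ W) (hW : convexHull ℝ (⋃ i, (P i + Q i)) ⊆ W)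
    (hvQ : v ∈ ⋃ i, (P i + Q i)) :
    ∃ i j : Fin r, i ≠ j ∧ v ∈ P i + Q i ∧ v ∈ P j + Q j :=
  hQ.2 v (inter_extremePoints_subset_extremePoints_of_subset hW
    ⟨subset_convexHull ℝ _ hvQ, hv⟩)

theorem IsSyzygy.convexHull_union {n r : ℕ} {P Q R : Fin r → Set (Fin n → ℝ)}
    (hP : ∀ i, Convex ℝ (P i)) (hQ : IsSyzygy P Q) (hR : IsSyzygy P R) :
    IsSyzygy P (fun i => convexHull ℝ (Q i ∪ R i)) := by
  refine ⟨fun i => (hQ.1 i).convexHull_union (hR.1 i), fun v hv => ?_⟩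
  have hW : convexHull ℝ (⋃ i, (P i + convexHull ℝ (Q i ∪ R i))) =
      convexHull ℝ ((⋃ i, (P i + Q i)) ∪ ⋃ i, (P i + R i)) := by
    have h (i : Fin r) : P i + convexHull ℝ (Q i ∪ R i) =
        convexHull ℝ ((P i + Q i) ∪ (P i + R i)) := by
      rw [← Set.add_union, convexHull_add, (hP i).convexHull_eq]
    simp_rw [h, convexHull_iUnion_convexHull, Set.iUnion_union_distrib]
  rw [hW] at hv
  have hsub (i : Fin r) := subset_convexHull ℝ (Q i ∪ R i)
  rcases extremePoints_convexHull_subset hv with hvQ | hvR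
  · obtain ⟨i, j, hij, hi, hj⟩ := hQ.exists_ne_of_mem_extremePoints hv
      (convexHull_mono Set.subset_union_left) hvQ
    exact ⟨i, j, hij,
      Set.add_subset_add_left (Set.subset_union_left.trans (hsub i)) hi,
      Set.add_subset_add_left (Set.subset_union_left.trans (hsub j)) hj⟩
  · obtain ⟨i, j, hij, hi, hj⟩ := hR.exists_ne_of_mem_extremePoints hv
      (convexHull_mono Set.subset_union_right) hvR
    exact ⟨i, j, hij,
      Set.add_subset_add_left (Set.subset_union_right.trans (hsub i)) hi,
      Set.add_subset_add_left (Set.subset_union_right.trans (hsub j)) hj⟩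

theorem IsSyzygy.add_left {n r : ℕ} {P Q : Fin r → Set (Fin n → ℝ)} (hQ : IsSyzygy P Q)
    {R₀ : Set (Fin n → ℝ)} (hR₀ : PolytopeSemiringElt R₀) :
    IsSyzygy P (fun i => R₀ + Q i) := by
  refine ⟨fun i => hR₀.add (hQ.1 i), fun v hv => ?_⟩
  simp_rw [add_left_comm (P _) R₀] at hv ⊢
  rw [← Set.add_iUnion, convexHull_add, hR₀.convex_s9.convexHull_eq] at hv
  obtain ⟨x, hx, w, hw, rfl⟩ := hv.1
  obtain ⟨i, j, hij, hi, hj⟩ := hQ.2 w (mem_extremePoints_of_add_mem_extremePoints hx hw hv)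
  exact ⟨i, j, hij, Set.add_mem_add hx hi, Set.add_mem_add hx hj⟩

/-- The set of syzygies of `(P₁, …, P_r)` is a semimodule over the polytope semiring: it is
closed under coordinatewise `⊕` and under coordinatewise Minkowski addition of a fixed
polytope-semiring element. -/
theorem syzygies_form_semimodule {n r : ℕ} (P : Fin r → Set (Fin n → ℝ))
    (hP : ∀ i, IsLatticePolytope (P i))
    (Q R : Fin r → Set (Fin n → ℝ))
    (hQ : IsSyzygy P Q) (hR : IsSyzygy P R) :
    IsSyzygy P (fun i => convexHull ℝ (Q i ∪ R i)) ∧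
      ∀ R₀ : Set (Fin n → ℝ), PolytopeSemiringElt R₀ →
        IsSyzygy P (fun i => R₀ + Q i) := by
  exact ⟨hQ.convexHull_union (fun i => (hP i).convex_s9) hR, fun _ hR₀ => hQ.add_left hR₀⟩
end

section
/- Let A, B, R be lattice polytopes in ℝⁿ with R containing more than one point, and set P₁ = A + R and P₂ = B + R (so P₁ and P₂ share the non-trivial Minkowski summand R). Then (P₁,P₂) is not a regular sequence: there exist lattice polytopes Q and T with Q + P₂ = P₁ + T such that Q ≠ P₁ + B′ for every lattice polytope B′. -/
open Pointwise

theorem IsLatticePolytope.nonempty_s13 {n : ℕ} {P : Set (Fin n → ℝ)} (hP : IsLatticePolytope P) :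
    P.Nonempty := by
  obtain ⟨F, hF, -, rfl⟩ := hP
  exact (Finset.coe_nonempty.2 hF).convexHull

theorem IsLatticePolytope.isCompact_s13 {n : ℕ} {P : Set (Fin n → ℝ)} (hP : IsLatticePolytope P) :
    IsCompact P := by
  obtain ⟨F, -, -, rfl⟩ := hP
  exact F.finite_toSet.isCompact_convexHull ℝ

/-- A translation mapping a nonempty compact set into itself is trivial. -/
theorem eq_zero_of_forall_add_mem {ι : Type*} {K : Set (ι → ℝ)} (hK : IsCompact K)
    (hne : K.Nonempty) {v : ι → ℝ} (hv : ∀ a ∈ K, a + v ∈ K) : v = 0 := by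
  funext i
  have hcont : ContinuousOn (fun x : ι → ℝ => x i) K := (continuous_apply i).continuousOn
  obtain ⟨a, ha, hmax⟩ := hK.exists_isMaxOn hne hcont
  obtain ⟨c, hc, hmin⟩ := hK.exists_isMinOn hne hcont
  have h₁ : a i + v i ≤ a i := hmax (hv a ha)
  have h₂ : c i ≤ c i + v i := hmin (hv c hc)
  rw [Pi.zero_apply]
  linarith

/-- If two lattice polytopes share a non-trivial Minkowski summand `R` (one containing more
than one point), then they do not form a regular sequence. -/
theorem shared_summand_not_regular {n : ℕ} (A B R : Set (Fin n → ℝ))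
    (hA : IsLatticePolytope A) (hB : IsLatticePolytope B) (hR : IsLatticePolytope R)
    (hRbig : ∃ a ∈ R, ∃ b ∈ R, a ≠ b)
    (P₁ P₂ : Set (Fin n → ℝ)) (hP₁ : P₁ = A + R) (hP₂ : P₂ = B + R) :
    ∃ Q T : Set (Fin n → ℝ), IsLatticePolytope Q ∧ IsLatticePolytope T ∧
      Q + P₂ = P₁ + T ∧
      ∀ B' : Set (Fin n → ℝ), IsLatticePolytope B' → Q ≠ P₁ + B' := by
  subst hP₁ hP₂
  refine ⟨A, B, hA, hB, by ac_rfl, fun B' hB' h => ?_⟩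
  obtain ⟨r, hr, s, hs, hne⟩ := hRbig
  obtain ⟨b, hb⟩ := hB'.nonempty_s13
  have translate_mem {t : Fin n → ℝ} (ht : t ∈ R) {a : Fin n → ℝ} (ha : a ∈ A) :
      a + (t + b) ∈ A := by
    rw [h, ← add_assoc]
    exact Set.add_mem_add (Set.add_mem_add ha ht) hb
  exact hne (add_right_cancel
    ((eq_zero_of_forall_add_mem hA.isCompact_s13 hA.nonempty_s13 fun _ => translate_mem hr).trans
      (eq_zero_of_forall_add_mem hA.isCompact_s13 hA.nonempty_s13 fun _ => translate_mem hs).symm))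
end

section
/- Let e₁,…,eₙ be the standard basis vectors of ℝⁿ. The sequence of singleton lattice polytopes ({e₁},…,{eₙ}) is a regular sequence of polytopes on the polytope semiring: for every i with 2 ≤ i ≤ n and every lattice polytope Q, if Q + {e_i} ∈ C({e₁},…,{e_{i−1}}) then Q ∈ C({e₁},…,{e_{i−1}}). -/
open Pointwise

/-- The sub-semimodule generated by a collection `S` of lattice polytopes. -/
def CSub {n : ℕ} (S : Set (Set (Fin n → ℝ))) : Set (Set (Fin n → ℝ)) :=
  {P | ∃ (J : Finset ℕ) (A B : ℕ → Set (Fin n → ℝ)), J.Nonempty ∧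
    (∀ j ∈ J, IsLatticePolytope (A j) ∧ B j ∈ S) ∧
    P = convexHull ℝ (⋃ j ∈ J, (A j + B j))}

lemma IsLatticePolytope.apply_nonneg {n : ℕ} {P : Set (Fin n → ℝ)} (hP : IsLatticePolytope P)
    {x : Fin n → ℝ} (hx : x ∈ P) (i : Fin n) : 0 ≤ x i := by
  obtain ⟨F, -, hF, rfl⟩ := hP
  have hconv : Convex ℝ {y : Fin n → ℝ | 0 ≤ y i} :=
    convex_halfSpace_ge (LinearMap.proj (R := ℝ) (φ := fun _ : Fin n => ℝ) i).isLinear 0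
  refine convexHull_min (fun y hy => ?_) hconv hx
  obtain ⟨m, hm⟩ := hF y hy i
  simp [hm]

lemma isLatticePolytope_singleton {n : ℕ} {x : Fin n → ℝ} (hx : ∀ i, ∃ m : ℕ, x i = m) :
    IsLatticePolytope {x} :=
  ⟨{x}, by simp, by simpa using hx, by simp⟩

lemma convexHull_extremePoints_convexHull_finset {n : ℕ} (F : Finset (Fin n → ℝ)) :
    convexHull ℝ ((convexHull ℝ (F : Set (Fin n → ℝ))).extremePoints ℝ) =
      convexHull ℝ (F : Set (Fin n → ℝ)) := by
  have hfin : ((convexHull ℝ (F : Set (Fin n → ℝ))).extremePoints ℝ).Finite :=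
    F.finite_toSet.subset extremePoints_convexHull_subset
  rw [← (hfin.isClosed_convexHull ℝ).closure_eq]
  exact closure_convexHull_extremePoints (F.finite_toSet.isCompact_convexHull ℝ)
    (convex_convexHull ℝ _)

lemma add_mem_extremePoints_add_singleton {E : Type*} [AddCommGroup E] [Module ℝ E] {P : Set E}
    {v : E} (hv : v ∈ P.extremePoints ℝ) (w : E) : v + w ∈ (P + {w}).extremePoints ℝ := by
  rw [mem_extremePoints_iff_left] at hv ⊢
  refine ⟨Set.add_mem_add hv.1 rfl, ?_⟩
  simp only [Set.add_singleton, Set.forall_mem_image]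
  intro p hp q hq h
  rw [add_comm p, add_comm q, add_comm v, mem_openSegment_translate] at h
  rw [hv.2 p hp q hq h]

/-- The convex hull of finitely many lattice points, each of which dominates a standard basis
vector from `K`, lies in the semimodule generated by the points of `K`. -/
lemma convexHull_mem_CSub {n : ℕ} {K : Set (Fin n)} {V : Set (Fin n → ℝ)} (hfin : V.Finite)
    (hne : V.Nonempty) (hV : ∀ v ∈ V, ∀ i, ∃ m : ℕ, v i = m) (hK : ∀ v ∈ V, ∃ k ∈ K, 1 ≤ v k) :
    convexHull ℝ V ∈ CSub {S | ∃ k : Fin n, k ∈ K ∧ S = {stdVec k}} := by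
  obtain ⟨f, hf⟩ := Set.countable_iff_exists_injOn.1 hfin.countable
  have : Nonempty (Fin n) := let ⟨v, hv⟩ := hne; ⟨(hK v hv).choose⟩
  choose! k hkK hk using hK
  have hinv : ∀ v ∈ V, Function.invFunOn f V (f v) = v := fun v hv =>
    hf.leftInvOn_invFunOn hv
  refine ⟨hfin.toFinset.image f,
    fun j => {Function.invFunOn f V j - stdVec (k (Function.invFunOn f V j))},
    fun j => {stdVec (k (Function.invFunOn f V j))}, by simpa using hne, ?_, ?_⟩
  · intro j hj
    obtain ⟨v, hv, rfl⟩ := Finset.mem_image.1 hj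
    rw [Set.Finite.mem_toFinset] at hv
    beta_reduce
    rw [hinv v hv]
    refine ⟨isLatticePolytope_singleton fun i => ?_, k v, hkK v hv, rfl⟩
    obtain ⟨m, hm⟩ := hV v hv i
    by_cases hi : i = k v
    · have h1 : 1 ≤ m := by
        have := hk v hv
        rw [← hi, hm] at this
        exact_mod_cast this
      exact ⟨m - 1, by simp [stdVec, hi, ← hm, Nat.cast_sub h1]⟩
    · exact ⟨m, by simp [stdVec, hi, hm]⟩
  · congr 1
    ext x
    simp only [Set.singleton_add_singleton, sub_add_cancel, Set.mem_iUnion, Finset.mem_image,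
      Set.Finite.mem_toFinset, Set.mem_singleton_iff, exists_prop, exists_exists_and_eq_and]
    constructor
    · exact fun hx => ⟨x, hx, (hinv x hx).symm⟩
    · rintro ⟨v, hv, rfl⟩
      rwa [hinv v hv]

/-- Every extreme point of a member of the semimodule generated by the points of `K` dominates a
standard basis vector from `K`. -/
lemma exists_one_le_of_mem_extremePoints {n : ℕ} {K : Set (Fin n)} {P : Set (Fin n → ℝ)}
    (hP : P ∈ CSub {S | ∃ k : Fin n, k ∈ K ∧ S = {stdVec k}}) {v : Fin n → ℝ}
    (hv : v ∈ P.extremePoints ℝ) : ∃ k ∈ K, 1 ≤ v k := by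
  obtain ⟨J, A, B, -, hAB, rfl⟩ := hP
  obtain ⟨j, hj, hvj⟩ := Set.mem_iUnion₂.1 (extremePoints_convexHull_subset hv)
  obtain ⟨hA, k, hk, hB⟩ := hAB j hj
  rw [hB] at hvj
  obtain ⟨a, ha, _, rfl, rfl⟩ := Set.mem_add.1 hvj
  exact ⟨k, hk, by simpa [stdVec] using hA.apply_nonneg ha k⟩

/-- The sequence of coordinate points `({e₁}, …, {eₙ})` is a regular sequence of polytopes
on the polytope semiring. -/
theorem coordinate_points_regular_sequence {n : ℕ} :
    ∀ i : Fin n, 0 < i.val → ∀ Q : Set (Fin n → ℝ), IsLatticePolytope Q →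
      Q + {stdVec i} ∈ CSub {S | ∃ j : Fin n, j < i ∧ S = {stdVec j}} →
      Q ∈ CSub {S | ∃ j : Fin n, j < i ∧ S = {stdVec j}} := by
  rintro i - Q ⟨F, hne, hF, rfl⟩ hQ
  have hsub := extremePoints_convexHull_subset (𝕜 := ℝ) (A := (F : Set (Fin n → ℝ)))
  have hhull := convexHull_extremePoints_convexHull_finset F
  rw [← hhull]
  refine convexHull_mem_CSub (K := Set.Iio i) (F.finite_toSet.subset hsub) ?_
    (fun v hv => hF v (hsub hv)) fun v hv => ?_
  · rw [← convexHull_nonempty_iff (𝕜 := ℝ), hhull]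
    exact (Finset.coe_nonempty.2 hne).convexHull
  · obtain ⟨k, hk, h⟩ := exists_one_le_of_mem_extremePoints (K := Set.Iio i) hQ
      (add_mem_extremePoints_add_singleton hv (stdVec i))
    exact ⟨k, hk, by simpa [stdVec, (Set.mem_Iio.1 hk).ne] using h⟩
end

section
/- Let K be an infinite field and let I be an ideal of K[x₁,…,xₙ] that contains every monomial of total degree d, for some d ∈ ℕ (i.e. the quotient by I is Artinian). Then I has a finite Newton basis: there is a finite set S of nonzero elements of I such that for every nonzero g ∈ I there exist a nonempty finite family (f_j)_{j∈J} of elements of S and lattice polytopes (Q_j)_{j∈J} with New(g) = convexHull ℝ (⋃_{j∈J} (New(f_j) + Q_j)). -/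
open Pointwise

/-- A finitely supported exponent vector dominates one of any prescribed smaller degree. -/
theorem Finsupp.exists_le_sum_eq {σ : Type*} (m : σ →₀ ℕ) (d : ℕ)
    (h : d ≤ m.sum fun _ e => e) : ∃ u ≤ m, (u.sum fun _ e => e) = d := by
  classical
  have hcard (v : σ →₀ ℕ) : Multiset.card (Finsupp.toMultiset v) = v.sum fun _ e => e :=
    Finsupp.card_toMultiset v
  refine ⟨Multiset.toFinsupp ((Finsupp.toMultiset m).toList.take d), ?_, ?_⟩
  · rw [← (Finsupp.orderIsoMultiset (ι := σ)).le_iff_le, Finsupp.coe_orderIsoMultiset,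
      Multiset.toFinsupp_toMultiset]
    conv_rhs => rw [← (Finsupp.toMultiset m).coe_toList]
    exact (List.take_sublist _ _).subperm
  · rw [← hcard, Multiset.toFinsupp_toMultiset]
    simpa [hcard] using h

/-- If `I` contains all monomials of degree `d`, it contains the part of degree less than `d` of
each of its elements. -/
theorem sum_low_monomials_mem {K : Type*} [Field K] {n : ℕ}
    (I : Ideal (MvPolynomial (Fin n) K)) (d : ℕ)
    (hArt : ∀ m : Fin n →₀ ℕ, (m.sum fun _ e => e) = d →
      (MvPolynomial.monomial m (1 : K)) ∈ I)
    (g : MvPolynomial (Fin n) K) (hg : g ∈ I) :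
    ∑ m ∈ g.support with (m.sum fun _ e => e) < d, MvPolynomial.monomial m (g.coeff m) ∈ I := by
  have hsplit := Finset.sum_filter_add_sum_filter_not g.support
    (fun m => (m.sum fun _ e => e) < d) (fun m => MvPolynomial.monomial m (g.coeff m))
  rw [← MvPolynomial.as_sum g] at hsplit
  rw [eq_sub_of_add_eq hsplit]
  refine I.sub_mem hg (I.sum_mem fun m hm => ?_)
  obtain ⟨u, hu, hd⟩ := Finsupp.exists_le_sum_eq m d (not_lt.1 (Finset.mem_filter.1 hm).2)
  have hmul : MvPolynomial.monomial m (g.coeff m) =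
      MvPolynomial.monomial (m - u) (g.coeff m) * MvPolynomial.monomial u 1 := by
    rw [MvPolynomial.monomial_mul, tsub_add_cancel_of_le hu, mul_one]
  rw [hmul]
  exact I.mul_mem_left _ (hArt u hd)

theorem support_sum_low_monomials {K : Type*} [Field K] {n : ℕ} (d : ℕ)
    (g : MvPolynomial (Fin n) K) :
    (∑ m ∈ g.support with (m.sum fun _ e => e) < d,
      MvPolynomial.monomial m (g.coeff m)).support =
      g.support.filter fun m => (m.sum fun _ e => e) < d := by
  ext m
  simp +contextual [MvPolynomial.coeff_sum, MvPolynomial.coeff_monomial]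

theorem isLatticePolytope_singleton_s16 {n : ℕ} (u : Fin n →₀ ℕ) :
    IsLatticePolytope {fun i => (u i : ℝ)} :=
  ⟨{fun i => (u i : ℝ)}, by simp, by simp, by simp⟩

/-- Any Artinian ideal (one containing all monomials of some total degree `d`) has a finite
Newton basis. -/
theorem artinian_ideal_finite_newton_basis {K : Type*} [Field K] [Infinite K] {n : ℕ}
    (I : Ideal (MvPolynomial (Fin n) K)) (d : ℕ)
    (hArt : ∀ m : Fin n →₀ ℕ, (m.sum fun _ e => e) = d →
      (MvPolynomial.monomial m (1 : K)) ∈ I) :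
    ∃ S : Finset (MvPolynomial (Fin n) K),
      (∀ f ∈ S, f ∈ I ∧ f ≠ 0) ∧
      ∀ g ∈ I, g ≠ 0 →
        ∃ (J : Finset ℕ) (f : ℕ → MvPolynomial (Fin n) K) (Q : ℕ → Set (Fin n → ℝ)),
          J.Nonempty ∧ (∀ j ∈ J, f j ∈ S ∧ IsLatticePolytope (Q j)) ∧
          newton g = convexHull ℝ (⋃ j ∈ J, (newton (f j) + Q j)) := by
  classical
  have hfin : {m : Fin n →₀ ℕ | (m.sum fun _ e => e) ≤ d}.Finite := Finsupp.finite_of_degree_le d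
  let T : Set (MvPolynomial (Fin n) K) :=
    {f | (f ∈ I ∧ f ≠ 0) ∧ ∀ m ∈ f.support, (m.sum fun _ e => e) ≤ d}
  obtain ⟨S, hST, hS⟩ := Set.SurjOn.exists_bijOn_subset (Set.surjOn_image MvPolynomial.support T)
  have hSfin : S.Finite := by
    refine hS.finite_iff_finite.2 (hfin.toFinset.powerset.finite_toSet.subset ?_)
    rintro _ ⟨f, hf, rfl⟩
    exact Finset.mem_coe.2 (Finset.mem_powerset.2 fun m hm => hfin.mem_toFinset.2 (hf.2 m hm))
  refine ⟨hSfin.toFinset, fun f hf => (hST (hSfin.mem_toFinset.1 hf)).1, fun g hg hg0 => ?_⟩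
  have hpiece : ∀ m ∈ g.support, ∃ (f : MvPolynomial (Fin n) K) (Q : Set (Fin n → ℝ)),
      (f ∈ hSfin.toFinset ∧ IsLatticePolytope Q) ∧
      (fun i => (m i : ℝ)) ∈ newton f + Q ∧ newton f + Q ⊆ newton g := by
    intro m hm
    by_cases hmd : (m.sum fun _ e => e) < d
    · have hlow : m ∈ g.support.filter fun m => (m.sum fun _ e => e) < d :=
        Finset.mem_filter.2 ⟨hm, hmd⟩
      have hsupp := support_sum_low_monomials d g
      obtain ⟨f, hf, hfs⟩ := hS.surjOn ⟨_, ⟨⟨sum_low_monomials_mem I d hArt g hg, by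
        rw [← MvPolynomial.support_nonempty, hsupp]
        exact ⟨m, hlow⟩⟩, by
        rw [hsupp]
        exact fun m hm => (Finset.mem_filter.1 hm).2.le⟩, hsupp⟩
      refine ⟨f, {0}, ⟨hSfin.mem_toFinset.2 hf, {0}, by simp, 
        by simpa using fun _ => ⟨0, Nat.cast_zero.symm⟩, by simp⟩, ?_⟩
      simp only [Set.singleton_zero, add_zero, newton, hfs]
      exact ⟨subset_convexHull ℝ _ ⟨m, hlow, rfl⟩,
        convexHull_mono (Set.image_mono (Finset.filter_subset _ _))⟩
    · obtain ⟨u, hu, hd⟩ := Finsupp.exists_le_sum_eq m d (not_lt.1 hmd)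
      have hsupp : (MvPolynomial.monomial u (1 : K)).support = {u} :=
        MvPolynomial.support_monomial.trans (if_neg one_ne_zero)
      obtain ⟨f, hf, hfs⟩ := hS.surjOn ⟨_, ⟨⟨hArt u hd, by simp⟩, by
        simp [hsupp, hd.le]⟩, hsupp⟩
      refine ⟨f, _, ⟨hSfin.mem_toFinset.2 hf, isLatticePolytope_singleton_s16 (m - u)⟩, ?_⟩
      have hadd : newton f + {fun i => ((m - u) i : ℝ)} = {fun i => (m i : ℝ)} := by
        simp only [newton, hfs, Finset.coe_singleton, Set.image_singleton, convexHull_singleton,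
          Set.singleton_add_singleton]
        congr 1
        funext i
        have := hu i
        simp [Nat.cast_sub this]
      rw [hadd]
      exact ⟨rfl, Set.singleton_subset_iff.2 (subset_convexHull ℝ _ ⟨m, hm, rfl⟩)⟩
  choose! F Q hFQ hmem hsub using hpiece
  obtain ⟨e, he⟩ := exists_injective_nat (Fin n →₀ ℕ)
  refine ⟨g.support.image e, F ∘ Function.invFun e, Q ∘ Function.invFun e,
    (MvPolynomial.support_nonempty.2 hg0).image e, ?_, ?_⟩
  · intro j hj
    obtain ⟨m, hm, rfl⟩ := Finset.mem_image.1 hj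
    simpa [Function.leftInverse_invFun he m] using hFQ m hm
  · apply subset_antisymm
    · refine convexHull_mono ?_
      rintro _ ⟨m, hm, rfl⟩
      simp only [Set.mem_iUnion]
      exact ⟨e m, Finset.mem_image_of_mem e hm, by
        simpa [Function.leftInverse_invFun he m] using hmem m hm⟩
    · refine convexHull_min (Set.iUnion₂_subset fun j hj => ?_) (convex_convexHull ℝ _)
      obtain ⟨m, hm, rfl⟩ := Finset.mem_image.1 hj
      simpa [Function.leftInverse_invFun he m] using hsub m hm
end

section
/- Let K be a field and let M ⊆ K[x₁,…,xₙ] be a monomial ideal whose minimal monomial generators are x^{u₁},…,x^{u_r}, where u₁,…,u_r ∈ ℕⁿ are pairwise incomparable in the componentwise order. Then {x^{u₁},…,x^{u_r}} is a minimal Newton basis of M: (i) for every nonzero f ∈ M there exist a nonempty subset T ⊆ {1,…,r} and lattice polytopes (Q_j)_{j∈T} with New(f) = convexHull ℝ (⋃_{j∈T} ({u_j} + Q_j)); and (ii) no proper subset of {x^{u₁},…,x^{u_r}} has property (i). -/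
open Pointwise

/-- The image in `ℝⁿ` of an exponent vector. -/
noncomputable def expVec {n : ℕ} (u : Fin n →₀ ℕ) : Fin n → ℝ :=
  fun i => (u i : ℝ)

/-- The Newton-basis property for the subfamily of monomial generators indexed by `s`:
the Newton polytope of every nonzero element of `M` is `convexHull ℝ (⋃_{j ∈ T} ({u j} + Q j))`
for some nonempty `T` with indices in `s` and lattice polytopes `Q j`. -/
def MonomialNewtonBasisProp {K : Type*} [Field K] {n r : ℕ}
    (M : Ideal (MvPolynomial (Fin n) K)) (u : Fin r → (Fin n →₀ ℕ))
    (s : Set (Fin r)) : Prop :=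
  ∀ f ∈ M, f ≠ 0 →
    ∃ T : Finset (Fin r), T.Nonempty ∧ ↑T ⊆ s ∧
      ∃ Q : Fin r → Set (Fin n → ℝ), (∀ j ∈ T, IsLatticePolytope (Q j)) ∧
        newton f = convexHull ℝ (⋃ j ∈ T, ({expVec (u j)} + Q j))

theorem expVec_add {n : ℕ} (u v : Fin n →₀ ℕ) : expVec (u + v) = expVec u + expVec v := by
  ext i
  simp [expVec]

/-- The convex hull of finitely many exponent vectors is a lattice polytope. -/
theorem isLatticePolytope_convexHull_expVec_image {n : ℕ} {S : Finset (Fin n →₀ ℕ)}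
    (hS : S.Nonempty) : IsLatticePolytope (convexHull ℝ (expVec '' (S : Set (Fin n →₀ ℕ)))) := by
  classical
  refine ⟨S.image expVec, hS.image _, fun x hx i => ?_, by rw [Finset.coe_image]⟩
  obtain ⟨d, -, rfl⟩ := Finset.mem_image.mp hx
  exact ⟨d i, rfl⟩

/-- A lattice polytope contains a point with nonnegative coordinates. -/
theorem IsLatticePolytope.exists_nonneg {n : ℕ} {P : Set (Fin n → ℝ)}
    (hP : IsLatticePolytope P) : ∃ x ∈ P, 0 ≤ x := by
  obtain ⟨F, ⟨x, hx⟩, hF, rfl⟩ := hP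
  refine ⟨x, subset_convexHull ℝ _ hx, fun i => ?_⟩
  obtain ⟨m, hm⟩ := hF x hx i
  simp [hm]

theorem newton_eq_convexHull_expVec_image {K : Type*} [CommSemiring K] {n : ℕ}
    (f : MvPolynomial (Fin n) K) :
    newton f = convexHull ℝ (expVec '' (f.support : Set (Fin n →₀ ℕ))) :=
  rfl

theorem newton_monomial {K : Type*} [CommSemiring K] {n : ℕ} (d : Fin n →₀ ℕ) {a : K}
    (ha : a ≠ 0) : newton (MvPolynomial.monomial d a) = {expVec d} := by
  classical
  rw [newton_eq_convexHull_expVec_image, MvPolynomial.support_monomial, if_neg ha,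
    Finset.coe_singleton, Set.image_singleton, convexHull_singleton]

/-- If every exponent of `f` dominates some `u j`, then the Newton polytope of `f` is the convex
hull of finitely many translates of lattice polytopes by the `u j`. -/
theorem exists_newton_eq_convexHull_iUnion {K : Type*} [CommSemiring K] {n : ℕ} {ι : Type*}
    [Fintype ι] (u : ι → (Fin n →₀ ℕ)) {f : MvPolynomial (Fin n) K} (hf : f ≠ 0)
    (h : ∀ d ∈ f.support, ∃ j, u j ≤ d) :
    ∃ T : Finset ι, T.Nonempty ∧ ∃ Q : ι → Set (Fin n → ℝ),
      (∀ j ∈ T, IsLatticePolytope (Q j)) ∧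
        newton f = convexHull ℝ (⋃ j ∈ T, ({expVec (u j)} + Q j)) := by
  classical
  let S : ι → Finset (Fin n →₀ ℕ) := fun j => {d ∈ f.support | u j ≤ d}
  let F : ι → Finset (Fin n →₀ ℕ) := fun j => (S j).image (· - u j)
  have translate (j : ι) : {expVec (u j)} + convexHull ℝ (expVec '' (F j : Set (Fin n →₀ ℕ))) =
      convexHull ℝ (expVec '' (S j : Set (Fin n →₀ ℕ))) := by
    rw [← convexHull_singleton (𝕜 := ℝ) (expVec (u j)), ← convexHull_add, Set.singleton_add,
      Finset.coe_image, Set.image_image, Set.image_image]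
    refine congrArg _ (Set.image_congr fun d hd => ?_)
    rw [← expVec_add, add_tsub_cancel_of_le (Finset.mem_filter.mp hd).2]
  refine ⟨Finset.univ.filter fun j => (S j).Nonempty, ?_,
    fun j => convexHull ℝ (expVec '' (F j : Set (Fin n →₀ ℕ))),
    fun j hj => isLatticePolytope_convexHull_expVec_image
      ((Finset.mem_filter.mp hj).2.image _), ?_⟩
  · obtain ⟨d, hd⟩ := MvPolynomial.support_nonempty.mpr hf
    obtain ⟨j, hj⟩ := h d hd
    exact ⟨j, Finset.mem_filter.mpr
      ⟨Finset.mem_univ j, d, Finset.mem_filter.mpr ⟨hd, hj⟩⟩⟩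
  · simp only [translate]
    rw [newton_eq_convexHull_expVec_image]
    apply subset_antisymm
    · refine convexHull_mono ?_
      rintro _ ⟨d, hd, rfl⟩
      obtain ⟨j, hj⟩ := h d hd
      have hdj : d ∈ S j := Finset.mem_filter.mpr ⟨hd, hj⟩
      exact Set.mem_biUnion (Finset.mem_filter.mpr ⟨Finset.mem_univ j, d, hdj⟩)
        (subset_convexHull ℝ _ (Set.mem_image_of_mem _ hdj))
    · exact convexHull_min
        (Set.iUnion₂_subset fun j _ => convexHull_mono
          (Set.image_mono (Finset.coe_subset.mpr (Finset.filter_subset _ _))))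
        (convex_convexHull ℝ _)

/-- The minimal monomial generators of a monomial ideal form a minimal Newton basis. -/
theorem monomial_minimal_generators_minimal_newton_basis {K : Type*} [Field K] {n r : ℕ}
    (u : Fin r → (Fin n →₀ ℕ))
    (hu : ∀ i j : Fin r, i ≠ j → ¬ u i ≤ u j)
    (M : Ideal (MvPolynomial (Fin n) K))
    (hM : M = Ideal.span (Set.range fun i => MvPolynomial.monomial (u i) (1 : K))) :
    MonomialNewtonBasisProp M u Set.univ ∧
      ∀ s : Set (Fin r), s ⊂ Set.univ → ¬ MonomialNewtonBasisProp M u s := by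
  subst hM
  constructor
  · intro f hf hf0
    rw [Set.range_comp' (fun d => MvPolynomial.monomial d (1 : K)) u,
      MvPolynomial.mem_ideal_span_monomial_image] at hf
    obtain ⟨T, hT, Q, hQ, hfQ⟩ := exists_newton_eq_convexHull_iUnion u hf0
      fun d hd => by simpa using hf d hd
    exact ⟨T, hT, Set.subset_univ _, Q, hQ, hfQ⟩
  · intro s hs hprop
    obtain ⟨i, -, hi⟩ := Set.exists_of_ssubset hs
    obtain ⟨T, ⟨j, hj⟩, hTs, Q, hQ, hnewton⟩ := hprop (MvPolynomial.monomial (u i) 1)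
      (Ideal.subset_span (Set.mem_range_self i)) (by simp)
    obtain ⟨x, hx, hx0⟩ := (hQ j hj).exists_nonneg
    have hmem : expVec (u j) + x ∈ newton (MvPolynomial.monomial (u i) (1 : K)) := by
      rw [hnewton]
      exact subset_convexHull ℝ _
        (Set.mem_biUnion hj (Set.add_mem_add (Set.mem_singleton _) hx))
    rw [newton_monomial _ one_ne_zero, Set.mem_singleton_iff] at hmem
    refine hu j i (fun hji => hi (hji ▸ hTs hj)) fun k => ?_
    have hle : expVec (u j) k ≤ expVec (u i) k := by
      rw [← hmem]
      exact le_add_of_nonneg_right (hx0 k)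
    exact Nat.cast_le.mp hle
end
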